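/- Let P be a finite set of points in ℝ² in general position, let k > 1, and let e_k be the number of pairs of points of P that are useful order-k Delaunay edges but not useful order-i Delaunay edges for any i < k. Then the number of triangulations of P that are order-k Delaunay but not order-i Delaunay for any i < k is at least 2^{e_k / C_k} − 1, where C_k = (4k+1)(2k+1)² + 1. -/

import Mathlib

open EuclideanGeometry Set

noncomputable section

/-- Points of the Euclidean plane. -/
abbrev Pt : Type := EuclideanSpace ℝ (Fin 2)

noncomputable instance : DecidableEq Pt := Classical.decEq _

/-- `P` is in general position: no three (distinct) points collinear and
no four (distinct) points concyclic. -/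
def GenPos (P : Set Pt) : Prop :=
  (∀ u v w : Pt, u ∈ P → v ∈ P → w ∈ P → u ≠ v → u ≠ w → v ≠ w →
    ¬ Collinear ℝ ({u, v, w} : Set Pt)) ∧
  (∀ u v w z : Pt, u ∈ P → v ∈ P → w ∈ P → z ∈ P →
    u ≠ v → u ≠ w → u ≠ z → v ≠ w → v ≠ z → w ≠ z →
    ¬ EuclideanGeometry.Cospherical ({u, v, w, z} : Set Pt))

/-- The (closed) triangle spanned by a finite set of points. -/
def triSet (t : Finset Pt) : Set Pt := convexHull ℝ (t : Set Pt)

/-- `T` is a triangulation of `P`: a finite set of triangles with vertices in `P`,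
every point of `P` is a vertex of some triangle, the interiors of the triangles are
pairwise disjoint, and their union is the convex hull of `P`. -/
def IsTriangulation (P : Set Pt) (T : Set (Finset Pt)) : Prop :=
  T.Finite ∧
  (∀ t ∈ T, t.card = 3 ∧ (t : Set Pt) ⊆ P) ∧
  (∀ p ∈ P, ∃ t ∈ T, p ∈ t) ∧
  (T.Pairwise fun t s => interior (triSet t) ∩ interior (triSet s) = ∅) ∧
  (⋃ t ∈ T, triSet t) = convexHull ℝ P

/-- The triangle `t` (with vertex set `t`) is order-`k` Delaunay with respect to `P`:
the open disk bounded by its circumcircle contains at most `k` points of `P`. -/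
def OrderKTri (P : Set Pt) (k : ℕ) (t : Finset Pt) : Prop :=
  ∃ z : Pt, ∃ r : ℝ, (∀ p ∈ t, dist p z = r) ∧ {p ∈ P | dist p z < r}.encard ≤ (k : ℕ∞)

/-- `T` is an order-`k` Delaunay triangulation of `P`. -/
def IsOrderDT (P : Set Pt) (k : ℕ) (T : Set (Finset Pt)) : Prop :=
  IsTriangulation P T ∧ ∀ t ∈ T, OrderKTri P k t

/-- `{u, v}` is an order-`k` Delaunay edge of `P`: some open disk having `u` and `v`
on its boundary circle contains at most `k` points of `P`. -/
def OrderKEdge (P : Set Pt) (k : ℕ) (u v : Pt) : Prop :=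
  ∃ z : Pt, ∃ r : ℝ, dist u z = r ∧ dist v z = r ∧ {p ∈ P | dist p z < r}.encard ≤ (k : ℕ∞)

/-- `{u, v}` is a useful order-`k` Delaunay edge of `P`: some order-`k` Delaunay
triangulation of `P` contains a triangle having `u` and `v` among its vertices
(i.e. having segment `uv` as a side). -/
def UsefulEdge (P : Set Pt) (k : ℕ) (u v : Pt) : Prop :=
  ∃ T, IsOrderDT P k T ∧ ∃ t ∈ T, u ∈ t ∧ v ∈ t

/-- `{u, v}` is a Delaunay edge: it is an edge of the (unique) order-0 Delaunay
triangulation of `P`. -/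
def DelaunayEdge (P : Set Pt) (u v : Pt) : Prop := UsefulEdge P 0 u v

/-- `p` lies strictly to the left of the directed line from `v` to `u`, i.e. the
triple `v, u, p` makes a counterclockwise turn. -/
def ccw (v u p : Pt) : Prop :=
  0 < (u 0 - v 0) * (p 1 - v 1) - (u 1 - v 1) * (p 0 - v 0)


/-- The set of unordered pairs of points of `P` that are useful order-`k` Delaunay edges
but not useful order-`i` Delaunay edges for any `i < k`. -/
def usefulExactly (P : Set Pt) (k : ℕ) : Set (Finset Pt) :=
  {e | ∃ u v : Pt, u ∈ P ∧ v ∈ P ∧ u ≠ v ∧ e = {u, v} ∧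
    UsefulEdge P k u v ∧ ∀ i < k, ¬ UsefulEdge P i u v}

/-- Real-valued affine functions on the plane. -/
abbrev AffFn : Type := Pt →ᵃ[ℝ] ℝ

/-- The squared norm, i.e. the height of the lift of a point to the paraboloid. -/
def sqn (p : Pt) : ℝ := ‖p‖ ^ 2

/-- Convex combinations of the points of `A` with strictly positive weights. -/
def openHull (A : Finset Pt) : Set Pt :=
  {z | ∃ w : Pt → ℝ, (∀ i ∈ A, 0 < w i) ∧ ∑ i ∈ A, w i = 1 ∧ ∑ i ∈ A, w i • i = z}

/-- A nondegenerate triangle. -/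
def Tri (t : Finset Pt) : Prop := t.card = 3 ∧ AffineIndependent ℝ ((↑) : t → Pt)

lemma AffFn.map_eq (f : AffFn) (x : Pt) : f x = f.linear x + f 0 := by
  have := congrFun (AffineMap.decomp f) x
  simpa using this

lemma AffFn.map_sum (f : AffFn) {A : Finset Pt} {w : Pt → ℝ} (hw : ∑ i ∈ A, w i = 1) :
    f (∑ i ∈ A, w i • i) = ∑ i ∈ A, w i * f i := by
  have h : ∀ i ∈ A, w i * f i = w i * f.linear i + w i * f 0 := fun i _ => by
    rw [f.map_eq i, mul_add]
  rw [f.map_eq, Finset.sum_congr rfl h, Finset.sum_add_distrib, ← Finset.sum_mul, hw]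
  simp [_root_.map_sum]

lemma AffFn.map_comb (f : AffFn) {a b : ℝ} (h : a + b = 1) (x y : Pt) :
    f (a • x + b • y) = a * f x + b * f y := by
  rw [f.map_eq, f.map_eq x, f.map_eq y]
  simp only [map_add, map_smul, smul_eq_mul]
  linear_combination (-(f 0)) * h

lemma AffFn.map_comb₃ (f : AffFn) {a b c : ℝ} (h : a + b + c = 1) (x y z : Pt) :
    f (a • x + b • y + c • z) = a * f x + b * f y + c * f z := by
  rw [f.map_eq, f.map_eq x, f.map_eq y, f.map_eq z]
  simp only [map_add, map_smul, smul_eq_mul]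
  linear_combination (-(f 0)) * h

lemma AffFn.continuous (f : AffFn) : Continuous f := f.continuous_of_finiteDimensional

lemma sqn_comb {a b : ℝ} (h : a + b = 1) (x y : Pt) :
    sqn (a • x + b • y) = a * sqn x + b * sqn y - a * b * sqn (x - y) := by
  unfold sqn
  rw [norm_add_sq_real, norm_sub_sq_real, norm_smul, norm_smul, mul_pow, mul_pow,
    real_inner_smul_left, real_inner_smul_right, Real.norm_eq_abs, Real.norm_eq_abs, sq_abs, sq_abs]
  obtain rfl : b = 1 - a := by linarith
  ring

lemma sqn_nonneg (x : Pt) : 0 ≤ sqn x := by unfold sqn; positivity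

lemma sqn_sub_pos {x y : Pt} (h : x ≠ y) : 0 < sqn (x - y) := by
  have := norm_pos_iff.2 (sub_ne_zero.2 h)
  unfold sqn; positivity

lemma convex_disk (f : AffFn) : Convex ℝ {z | sqn z ≤ f z} := by
  intro x hx y hy a b ha hb hab
  simp only [mem_ofPred_eq] at *
  rw [sqn_comb hab, f.map_comb hab]
  have := mul_nonneg (mul_nonneg ha hb) (sqn_nonneg (x - y))
  nlinarith

lemma sqn_lt_of_openSegment {f : AffFn} {x y z : Pt} (hx : sqn x ≤ f x) (hy : sqn y ≤ f y)
    (hxy : x ≠ y) (hz : z ∈ openSegment ℝ x y) : sqn z < f z := by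
  obtain ⟨a, b, ha, hb, hab, rfl⟩ := hz
  rw [sqn_comb hab, f.map_comb hab]
  have := mul_pos (mul_pos ha hb) (sqn_sub_pos hxy)
  nlinarith

lemma sqn_lt_of_openSegment' {f : AffFn} {x y z : Pt} (hx : sqn x < f x) (hy : sqn y ≤ f y)
    (hz : z ∈ openSegment ℝ x y) : sqn z < f z := by
  by_cases hxy : x = y
  · subst hxy
    rw [openSegment_same] at hz
    rwa [mem_singleton_iff.1 hz]
  · exact sqn_lt_of_openSegment hx.le hy hxy hz

lemma sqn_le_of_mem_triSet {f : AffFn} {t : Finset Pt} (h : ∀ i ∈ t, sqn i ≤ f i) {z : Pt}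
    (hz : z ∈ triSet t) : sqn z ≤ f z :=
  convexHull_min (s := (t : Set Pt)) (t := {z | sqn z ≤ f z}) h (convex_disk f) hz

/-- Circles correspond to non-vertical planes intersecting the paraboloid. -/
lemma exists_center (f : AffFn) : ∃ z : Pt, ∃ c : ℝ, ∀ p, dist p z ^ 2 = sqn p - f p + c := by
  set n : Pt := (InnerProductSpace.toDual ℝ Pt).symm f.linear.toContinuousLinearMap with hn
  have h : ∀ p, inner ℝ n p = f.linear p := by
    intro p
    rw [hn, InnerProductSpace.toDual_symm_apply]
    rfl
  refine ⟨(1 / 2 : ℝ) • n, f 0 + sqn ((1 / 2 : ℝ) • n), fun p => ?_⟩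
  rw [f.map_eq p, dist_eq_norm, norm_sub_sq_real, real_inner_smul_right, real_inner_comm, h]
  unfold sqn
  ring

lemma exists_affFn_of_circle (z : Pt) (r : ℝ) :
    ∃ f : AffFn, ∀ p, sqn p - f p = dist p z ^ 2 - r ^ 2 := by
  refine ⟨((2 : ℝ) • (innerSL ℝ z : Pt →ₗ[ℝ] ℝ)).toAffineMap +
    AffineMap.const ℝ Pt (r ^ 2 - sqn z), fun p => ?_⟩
  rw [dist_eq_norm, norm_sub_sq_real, real_inner_comm]
  simp [sqn]
  ring

lemma orderKTri_of_affFn {P : Set Pt} {k : ℕ} {t : Finset Pt} (ht : t.Nonempty) {f : AffFn}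
    (hf : ∀ i ∈ t, f i = sqn i) (hk : {p ∈ P | sqn p < f p}.encard ≤ (k : ℕ∞)) :
    OrderKTri P k t := by
  obtain ⟨z, c, hz⟩ := exists_center f
  obtain ⟨a, ha⟩ := ht
  have hc : 0 ≤ c := by
    have := hz a
    rw [hf a ha] at this
    nlinarith [sq_nonneg (dist a z)]
  refine ⟨z, √c, fun p hp => ?_, ?_⟩
  · rw [← Real.sqrt_sq (dist_nonneg (x := p) (y := z)), hz, hf p hp]
    simp
  · convert hk using 5 with p
    rw [Real.lt_sqrt dist_nonneg, hz]
    constructor <;> intro h <;> linarith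

lemma OrderKTri.exists_affFn {P : Set Pt} {k : ℕ} {t : Finset Pt} (ht : t.Nonempty)
    (h : OrderKTri P k t) : ∃ f : AffFn, (∀ i ∈ t, f i = sqn i) ∧
      {p ∈ P | sqn p < f p}.encard ≤ (k : ℕ∞) := by
  obtain ⟨z, r, hr, hk⟩ := h
  obtain ⟨f, hf⟩ := exists_affFn_of_circle z r
  obtain ⟨a, ha⟩ := ht
  have hr0 : 0 ≤ r := hr a ha ▸ dist_nonneg
  refine ⟨f, fun i hi => ?_, ?_⟩
  · have := hf i
    rw [hr i hi] at this
    linarith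
  · convert hk using 5 with p
    rw [← sq_lt_sq₀ dist_nonneg hr0]
    have := hf p
    constructor <;> intro h <;> linarith

lemma GenPos.mono {P Q : Set Pt} (h : GenPos P) (hQ : Q ⊆ P) : GenPos Q :=
  ⟨fun u v w hu hv hw => h.1 u v w (hQ hu) (hQ hv) (hQ hw),
    fun u v w z hu hv hw hz => h.2 u v w z (hQ hu) (hQ hv) (hQ hw) (hQ hz)⟩

lemma GenPos.mem_of_eq {P : Set Pt} (hP : GenPos P) {t : Finset Pt} (ht : t.card = 3)
    (htP : (t : Set Pt) ⊆ P) {f : AffFn} (hf : ∀ i ∈ t, f i = sqn i) {p : Pt} (hp : p ∈ P)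
    (hpf : f p = sqn p) : p ∈ t := by
  by_contra hpt
  obtain ⟨a, b, c, hab, hac, hbc, rfl⟩ := Finset.card_eq_three.1 ht
  simp only [Finset.coe_insert, Finset.coe_singleton, insert_subset_iff,
    singleton_subset_iff] at htP
  simp only [Finset.mem_insert, Finset.mem_singleton, not_or] at hpt
  obtain ⟨z, r, hz⟩ := exists_center f
  refine hP.2 a b c p htP.1 htP.2.1 htP.2.2 hp hab hac (Ne.symm hpt.1) hbc (Ne.symm hpt.2.1)
    (Ne.symm hpt.2.2) ⟨z, √r, ?_⟩
  intro q hq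
  have hq' : f q = sqn q := by
    rcases hq with rfl | rfl | rfl | rfl
    · exact hf _ (by simp)
    · exact hf _ (by simp)
    · exact hf _ (by simp)
    · exact hpf
  rw [← Real.sqrt_sq (dist_nonneg (x := q) (y := z)), hz, hq']
  simp

lemma GenPos.tri {P : Set Pt} (hP : GenPos P) {t : Finset Pt} (ht : t.card = 3)
    (htP : (t : Set Pt) ⊆ P) : Tri t := by
  refine ⟨ht, ?_⟩
  obtain ⟨a, b, c, hab, hac, hbc, rfl⟩ := Finset.card_eq_three.1 ht
  simp only [Finset.coe_insert, Finset.coe_singleton, insert_subset_iff,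
    singleton_subset_iff] at htP
  have h := affineIndependent_iff_not_collinear_set.2
    (hP.1 a b c htP.1 htP.2.1 htP.2.2 hab hac hbc)
  have h2 := h.range
  have e : range ![a, b, c] = ((({a, b, c} : Finset Pt)) : Set Pt) := by
    simp only [Matrix.range_cons, Matrix.range_empty, union_empty, singleton_union,
      Finset.coe_insert, Finset.coe_singleton]
  rw [e] at h2
  exact h2

/-- Barycentric coordinates with respect to a nondegenerate triangle. -/
lemma Tri.exists_bary {t : Finset Pt} (ht : Tri t) : ∃ β : Pt → AffFn,
    (∀ x, ∑ i ∈ t, β i x = 1) ∧ (∀ x, ∑ i ∈ t, β i x • i = x) ∧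
    (∀ i ∈ t, ∀ j ∈ t, β i j = if i = j then 1 else 0) ∧
    interior (triSet t) = {x | ∀ i ∈ t, 0 < β i x} ∧ triSet t = {x | ∀ i ∈ t, 0 ≤ β i x} := by
  have htop : affineSpan ℝ (range ((↑) : t → Pt)) = ⊤ := by
    rw [ht.2.affineSpan_eq_top_iff_card_eq_finrank_add_one]
    simp [ht.1]
  let b : AffineBasis t ℝ Pt := ⟨(↑), ht.2, htop⟩
  have hb : ∀ i : t, b i = i := fun i => rfl
  have hr : range b = (t : Set Pt) := by
    change range ((↑) : t → Pt) = _
    exact Subtype.range_coe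
  refine ⟨fun i => if h : i ∈ t then b.coord ⟨i, h⟩ else 0, fun x => ?_, fun x => ?_, ?_, ?_, ?_⟩
  · rw [← b.sum_coord_apply_eq_one x, ← Finset.sum_coe_sort]
    exact Finset.sum_congr rfl fun i _ => by simp
  · conv_rhs => rw [← b.linear_combination_coord_eq_self x]
    rw [← Finset.sum_coe_sort]
    exact Finset.sum_congr rfl fun i _ => by simp [hb]
  · intro i hi j hj
    have := b.coord_apply ⟨i, hi⟩ ⟨j, hj⟩
    simp only [hb] at this
    simp [hi, this]
  · have := b.interior_convexHull
    rw [hr] at this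
    unfold triSet
    rw [this]
    ext x
    simp only [mem_ofPred_eq, Subtype.forall]
    exact forall₂_congr fun i hi => by simp [hi]
  · have := b.convexHull_eq_nonneg_coord
    rw [hr] at this
    unfold triSet
    rw [this]
    ext x
    simp only [mem_ofPred_eq, Subtype.forall]
    exact forall₂_congr fun i hi => by simp [hi]

lemma AffFn.sub_apply (f g : AffFn) (x : Pt) : (f - g) x = f x - g x := rfl

lemma AffFn.nonneg_of_mem_triSet {f : AffFn} {A : Finset Pt} {z : Pt} (h : ∀ i ∈ A, 0 ≤ f i)
    (hz : z ∈ triSet A) : 0 ≤ f z := by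
  obtain ⟨w, hw0, hw1, rfl⟩ := Finset.mem_convexHull'.1 hz
  rw [f.map_sum hw1]
  exact Finset.sum_nonneg fun i hi => mul_nonneg (hw0 i hi) (h i hi)

lemma AffFn.le_of_mem_triSet {f g : AffFn} {A : Finset Pt} {z : Pt} (h : ∀ i ∈ A, f i ≤ g i)
    (hz : z ∈ triSet A) : f z ≤ g z := by
  have := AffFn.nonneg_of_mem_triSet (f := g - f) (fun i hi => by
    rw [AffFn.sub_apply]; linarith [h i hi]) hz
  rw [AffFn.sub_apply] at this
  linarith

lemma AffFn.eq_of_mem_openHull {f g : AffFn} {A : Finset Pt} {z : Pt} (h : ∀ i ∈ A, f i ≤ g i)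
    (hz : z ∈ openHull A) (h0 : g z ≤ f z) : ∀ i ∈ A, f i = g i := by
  obtain ⟨w, hw0, hw1, rfl⟩ := hz
  rw [f.map_sum hw1, g.map_sum hw1] at h0
  have hle : ∀ i ∈ A, w i * f i ≤ w i * g i := fun i hi =>
    mul_le_mul_of_nonneg_left (h i hi) (hw0 i hi).le
  have := (Finset.sum_eq_sum_iff_of_le hle).1 (le_antisymm (Finset.sum_le_sum hle) h0)
  exact fun i hi => mul_left_cancel₀ (hw0 i hi).ne' (this i hi)

/-- Two locally Delaunay cells meeting in the relative interior of the second one. -/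
lemma compat {A A' : Finset Pt} {f g : AffFn} {z : Pt} (hf : ∀ i ∈ A, f i = sqn i)
    (hg : ∀ i ∈ A', g i = sqn i) (hf' : ∀ i ∈ A', f i ≤ sqn i) (hg' : ∀ i ∈ A, g i ≤ sqn i)
    (hz : z ∈ triSet A) (hz' : z ∈ openHull A') : ∀ i ∈ A', f i = sqn i := by
  have h1 := AffFn.le_of_mem_triSet (f := g) (g := f) (fun i hi => by
    rw [hf i hi]; exact hg' i hi) hz
  have h2 := AffFn.eq_of_mem_openHull (f := f) (g := g) (fun i hi => by
    rw [hg i hi]; exact hf' i hi) hz' h1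
  exact fun i hi => (h2 i hi).trans (hg i hi)

lemma openHull_subset_triSet (A : Finset Pt) : openHull A ⊆ triSet A := by
  rintro z ⟨w, hw0, hw1, rfl⟩
  exact Finset.mem_convexHull'.2 ⟨w, fun i hi => (hw0 i hi).le, hw1, rfl⟩

lemma exists_support {A : Finset Pt} {z : Pt} (hz : z ∈ triSet A) :
    ∃ B ⊆ A, z ∈ openHull B := by
  obtain ⟨w, hw0, hw1, rfl⟩ := Finset.mem_convexHull'.1 hz
  refine ⟨A.filter fun i => 0 < w i, Finset.filter_subset _ _, w, fun i hi =>
    (Finset.mem_filter.1 hi).2, ?_, ?_⟩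
  · rw [← hw1]
    refine Finset.sum_filter_of_ne fun i hi h => lt_of_le_of_ne (hw0 i hi) (Ne.symm h)
  · refine Finset.sum_filter_of_ne fun i hi h => lt_of_le_of_ne (hw0 i hi) ?_
    rintro h0
    simp [← h0] at h

lemma openHull_singleton {a z : Pt} (hz : z ∈ openHull {a}) : z = a := by
  obtain ⟨w, -, hw1, rfl⟩ := hz
  simp only [Finset.sum_singleton] at *
  rw [hw1, one_smul]

lemma openHull_pair {a b : Pt} (hab : a ≠ b) : openHull {a, b} = openSegment ℝ a b := by
  ext z
  constructor
  · rintro ⟨w, hw0, hw1, rfl⟩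
    rw [Finset.sum_pair hab] at *
    exact ⟨w a, w b, hw0 a (by simp), hw0 b (by simp), hw1, rfl⟩
  · rintro ⟨x, y, hx, hy, hxy, rfl⟩
    refine ⟨fun p => if p = a then x else y, fun i _ => ?_, ?_, ?_⟩
    · dsimp only; split_ifs <;> assumption
    · rw [Finset.sum_pair hab]; simp [hab.symm, hxy]
    · rw [Finset.sum_pair hab]; simp [hab.symm]

lemma mem_triSet {A : Finset Pt} {a : Pt} (h : a ∈ A) : a ∈ triSet A :=
  subset_convexHull ℝ _ h

lemma segment_subset_triSet {A : Finset Pt} {a b : Pt} (ha : a ∈ triSet A) (hb : b ∈ triSet A) :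
    segment ℝ a b ⊆ triSet A :=
  (convex_convexHull ℝ _).segment_subset ha hb

lemma isClosed_triSet (t : Finset Pt) : IsClosed (triSet t) :=
  (Finite.isClosed_convexHull ℝ t.finite_toSet)

lemma Tri.interior_eq {t : Finset Pt} (ht : Tri t) : interior (triSet t) = openHull t := by
  obtain ⟨β, h1, h2, h3, h4, -⟩ := ht.exists_bary
  rw [h4]
  ext x
  constructor
  · intro hx
    exact ⟨fun i => β i x, hx, h1 x, h2 x⟩
  · rintro ⟨w, hw0, hw1, rfl⟩ i hi
    rw [(β i).map_sum hw1, Finset.sum_congr rfl fun j hj => by rw [h3 i hi j hj]]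
    simpa [hi] using hw0 i hi

lemma AffFn.exists_sum (t : Finset Pt) (F : Pt → ℝ) (β : Pt → AffFn) :
    ∃ f : AffFn, ∀ x, f x = ∑ i ∈ t, F i * β i x := by
  induction t using Finset.induction_on with
  | empty => exact ⟨0, fun x => by simp⟩
  | insert a s ha ih =>
    obtain ⟨f, hf⟩ := ih
    refine ⟨F a • β a + f, fun x => ?_⟩
    rw [Finset.sum_insert ha, ← hf]
    rfl

lemma Tri.exists_interp {t : Finset Pt} (ht : Tri t) (F : Pt → ℝ) :
    ∃ f : AffFn, ∀ i ∈ t, f i = F i := by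
  obtain ⟨β, h1, h2, h3, -, -⟩ := ht.exists_bary
  obtain ⟨f, hf⟩ := AffFn.exists_sum t F β
  refine ⟨f, fun j hj => ?_⟩
  rw [hf, Finset.sum_congr rfl fun i hi => by rw [h3 i hi j hj]]
  simp [hj]

lemma Tri.openHull_nonempty {t : Finset Pt} (ht : Tri t) : (openHull t).Nonempty := by
  refine ⟨_, fun _ => 1 / 3, fun _ _ => by norm_num, ?_, rfl⟩
  simp [ht.1]

lemma Tri.triSet_subset_closure {t : Finset Pt} (ht : Tri t) :
    triSet t ⊆ closure (interior (triSet t)) := by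
  have hne : (interior (triSet t)).Nonempty := ht.interior_eq ▸ ht.openHull_nonempty
  unfold triSet at *
  rw [(convex_convexHull ℝ _).closure_interior_eq_closure_of_nonempty_interior hne]
  exact subset_closure

/-- Signed height over the line `a b`. -/
def hgt (a b : Pt) : AffFn :=
  ((b 0 - a 0) • (EuclideanSpace.proj (𝕜 := ℝ) (1 : Fin 2)).toLinearMap
    - (b 1 - a 1) • (EuclideanSpace.proj (𝕜 := ℝ) (0 : Fin 2)).toLinearMap :
      Pt →ₗ[ℝ] ℝ).toAffineMap +
    AffineMap.const ℝ Pt ((b 1 - a 1) * a 0 - (b 0 - a 0) * a 1)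

lemma hgt_apply (a b p : Pt) :
    hgt a b p = (b 0 - a 0) * (p 1 - a 1) - (b 1 - a 1) * (p 0 - a 0) := by
  simp [hgt]
  ring

lemma hgt_left (a b : Pt) : hgt a b a = 0 := by rw [hgt_apply]; ring

lemma hgt_right (a b : Pt) : hgt a b b = 0 := by rw [hgt_apply]; ring

lemma hgt_swap (a b p : Pt) : hgt b a p = -hgt a b p := by rw [hgt_apply, hgt_apply]; ring

lemma hgt_rot (a b p : Pt) : hgt b p a = hgt a b p := by rw [hgt_apply, hgt_apply]; ring

lemma exists_of_hgt_eq_zero {a b p : Pt} (hab : a ≠ b) (h : hgt a b p = 0) :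
    ∃ r : ℝ, p = (1 - r) • a + r • b := by
  rw [hgt_apply] at h
  by_cases h0 : b 0 - a 0 = 0
  · have h1 : b 1 - a 1 ≠ 0 := by
      intro h1
      apply hab
      ext i
      fin_cases i
      · simp; linarith
      · simp; linarith
    have h2 : p 0 - a 0 = 0 := by
      rw [h0] at h
      simpa [h1] using h
    refine ⟨(p 1 - a 1) / (b 1 - a 1), ?_⟩
    ext i
    fin_cases i
    · simp
      field_simp
      nlinarith
    · simp
      field_simp
      ring
  · refine ⟨(p 0 - a 0) / (b 0 - a 0), ?_⟩
    ext i
    fin_cases i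
    · simp
      field_simp
      ring
    · simp
      field_simp
      linarith

lemma GenPos.hgt_ne {P : Set Pt} (hP : GenPos P) {a b c : Pt} (ha : a ∈ P) (hb : b ∈ P)
    (hc : c ∈ P) (hab : a ≠ b) (hac : a ≠ c) (hbc : b ≠ c) : hgt a b c ≠ 0 := by
  intro h
  obtain ⟨r, hr⟩ := exists_of_hgt_eq_zero hab h
  refine hP.1 a b c ha hb hc hab hac hbc ?_
  rw [collinear_iff_of_mem (p₀ := a) (by simp)]
  refine ⟨b - a, ?_⟩
  rintro p (rfl | rfl | rfl)
  · exact ⟨0, by simp⟩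
  · exact ⟨1, by simp⟩
  · refine ⟨r, ?_⟩
    rw [hr, vadd_eq_add]
    module

/-- Points off all lines spanned by two points of `Q`. -/
def Generic (Q : Set Pt) : Set Pt := {x | ∀ a ∈ Q, ∀ b ∈ Q, a ≠ b → hgt a b x ≠ 0}

lemma dense_hgt_ne {a b : Pt} (hab : a ≠ b) : Dense {x | hgt a b x ≠ 0} := by
  obtain ⟨c, hc⟩ : ∃ c, hgt a b c ≠ 0 := by
    refine ⟨!₂[a 0 - (b 1 - a 1), a 1 + (b 0 - a 0)], fun h => hab ?_⟩
    rw [hgt_apply] at h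
    simp at h
    ext i
    fin_cases i
    · simp; nlinarith [sq_nonneg (b 0 - a 0), sq_nonneg (b 1 - a 1)]
    · simp; nlinarith [sq_nonneg (b 0 - a 0), sq_nonneg (b 1 - a 1)]
  intro x
  by_cases hx : hgt a b x = 0
  · have hcont : Continuous fun r : ℝ => (1 - r) • x + r • c := by fun_prop
    have h := image_closure_subset_closure_image hcont (s := {0}ᶜ)
    rw [(dense_compl_singleton (0 : ℝ)).closure_eq] at h
    refine closure_mono ?_ (h ⟨0, mem_univ _, by simp⟩)
    rintro _ ⟨r, hr, rfl⟩
    rw [mem_ofPred_eq, (hgt a b).map_comb (by ring), hx]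
    simpa [hc] using hr
  · exact subset_closure hx

lemma isOpen_hgt_ne (a b : Pt) : IsOpen {x | hgt a b x ≠ 0} :=
  isOpen_ne_fun (hgt a b).continuous continuous_const

lemma exists_generic {Q : Set Pt} (hQ : Q.Finite) {U : Set Pt} (hU : IsOpen U)
    (hne : U.Nonempty) : ∃ x ∈ U, x ∈ Generic Q := by
  have hd : Dense (⋂ e ∈ {e : Pt × Pt | e ∈ Q ×ˢ Q ∧ e.1 ≠ e.2}, {x | hgt e.1 e.2 x ≠ 0}) :=
    dense_biInter_of_isOpen (fun e _ => isOpen_hgt_ne e.1 e.2)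
      ((hQ.prod hQ).subset fun e he => he.1).countable (fun e he => dense_hgt_ne he.2)
  obtain ⟨x, hx, hxU⟩ := hd.inter_open_nonempty U hU hne
  refine ⟨x, hx, fun a ha b hb hab => ?_⟩
  exact mem_iInter₂.1 hxU (a, b) ⟨⟨ha, hb⟩, hab⟩

/-- `t` is a Delaunay triangle of `Q`, witnessed by a plane below the lifted points. -/
def IsDel (Q : Set Pt) (t : Finset Pt) : Prop :=
  t.card = 3 ∧ (t : Set Pt) ⊆ Q ∧ ∃ f : AffFn, (∀ i ∈ t, f i = sqn i) ∧ ∀ q ∈ Q, f q ≤ sqn q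

lemma Generic.three_le_card {Q : Set Pt} {x : Pt} (hx : x ∈ Generic Q) (hQ : Q.Nontrivial)
    {B : Finset Pt} (hB : (B : Set Pt) ⊆ Q) (hxB : x ∈ triSet B) : 3 ≤ B.card := by
  by_contra! h
  obtain ⟨a, ha, b, hb, hab, hBab⟩ : ∃ a ∈ Q, ∃ b ∈ Q, a ≠ b ∧ B ⊆ {a, b} := by
    have : B.card = 0 ∨ B.card = 1 ∨ B.card = 2 := by omega
    rcases this with h | h | h
    · obtain ⟨a, ha, b, hb, hab⟩ := hQ
      refine ⟨a, ha, b, hb, hab, ?_⟩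
      simp [Finset.card_eq_zero.1 h]
    · obtain ⟨a, rfl⟩ := Finset.card_eq_one.1 h
      obtain ⟨b, hb, hba⟩ := hQ.exists_ne a
      exact ⟨a, hB (by simp), b, hb, hba.symm, by simp⟩
    · obtain ⟨a, b, hab, rfl⟩ := Finset.card_eq_two.1 h
      exact ⟨a, hB (by simp), b, hB (by simp), hab, subset_rfl⟩
  have hz : ∀ i ∈ B, hgt a b i = (0 : AffFn) i := fun i hi => by
    have := hBab hi
    simp only [Finset.mem_insert, Finset.mem_singleton] at this
    rcases this with rfl | rfl
    · exact hgt_left _ _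
    · exact hgt_right _ _
  refine hx a ha b hb hab (le_antisymm ?_ ?_)
  · exact AffFn.le_of_mem_triSet (fun i hi => (hz i hi).le) hxB
  · exact AffFn.le_of_mem_triSet (fun i hi => (hz i hi).ge) hxB

lemma Generic.mem_openHull {Q : Set Pt} {x : Pt} (hx : x ∈ Generic Q) (hQ : Q.Nontrivial)
    {t : Finset Pt} (ht : t.card = 3) (htQ : (t : Set Pt) ⊆ Q) (hxt : x ∈ triSet t) :
    x ∈ openHull t := by
  obtain ⟨B, hBt, hxB⟩ := exists_support hxt
  have := Generic.three_le_card hx hQ ((Finset.coe_subset.2 hBt).trans htQ)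
    (openHull_subset_triSet _ hxB)
  rwa [← Finset.eq_of_subset_of_card_le hBt (by omega)]

lemma Generic.exists_triangle {Q : Set Pt} {x : Pt} (hx : x ∈ Generic Q) (hQ : Q.Nontrivial)
    (hxQ : x ∈ convexHull ℝ Q) : ∃ t : Finset Pt, t.card = 3 ∧ (t : Set Pt) ⊆ Q ∧ x ∈ triSet t := by
  rw [convexHull_eq_union] at hxQ
  simp only [mem_iUnion] at hxQ
  obtain ⟨t, htQ, hind, hxt⟩ := hxQ
  refine ⟨t, le_antisymm ?_ (Generic.three_le_card hx hQ htQ hxt), htQ, hxt⟩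
  have := hind.card_le_finrank_succ
  rw [Fintype.card_coe] at this
  refine this.trans ?_
  have := Submodule.finrank_le (vectorSpan ℝ (range ((↑) : t → Pt)))
  simp at this
  omega

/-- Exchanging a vertex of a triangle containing `x` for a point below its plane. -/
lemma exists_exchange {t : Finset Pt} (ht : Tri t) {f : AffFn} (hf : ∀ i ∈ t, f i = sqn i)
    {p x : Pt} (hp : sqn p < f p) (hx : x ∈ openHull t) :
    ∃ i ∈ t, x ∈ triSet (insert p (t.erase i)) ∧ p ∉ t ∧
      ∀ g : AffFn, (∀ j ∈ insert p (t.erase i), g j = sqn j) → g x < f x := by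
  have hpt : p ∉ t := fun h => by
    rw [hf p h] at hp
    exact lt_irrefl _ hp
  obtain ⟨β, h1, h2, h3, -, -⟩ := ht.exists_bary
  obtain ⟨w, hw0, hw1, hwx⟩ := hx
  have hne : (t.filter fun i => 0 < β i p).Nonempty := by
    by_contra hne
    rw [Finset.not_nonempty_iff_eq_empty, Finset.filter_eq_empty_iff] at hne
    have := h1 p
    have h := Finset.sum_nonpos (s := t) (f := fun i => β i p) fun i hi => not_lt.1 (hne hi)
    linarith
  obtain ⟨i, hi, hmin⟩ := Finset.exists_min_image _ (fun i => w i / β i p) hne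
  rw [Finset.mem_filter] at hi
  obtain ⟨hit, hi0⟩ := hi
  set s := w i / β i p with hs
  have hs0 : 0 < s := div_pos (hw0 i hit) hi0
  have hsi : w i - s * β i p = 0 := by rw [hs]; field_simp; ring
  have hnn : ∀ j ∈ t, 0 ≤ w j - s * β j p := by
    intro j hj
    by_cases hj0 : 0 < β j p
    · have := hmin j (Finset.mem_filter.2 ⟨hj, hj0⟩)
      rw [le_div_iff₀ hj0] at this
      linarith
    · have := hw0 j hj
      nlinarith
  have hsum1 : ∑ j ∈ t.erase i, (w j - s * β j p) = 1 - s := by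
    rw [Finset.sum_erase (f := fun j => w j - s * β j p) t hsi, Finset.sum_sub_distrib,
      ← Finset.mul_sum, hw1, h1]
    ring
  have hsum2 : ∑ j ∈ t.erase i, (w j - s * β j p) • j = x - s • p := by
    rw [Finset.sum_erase (f := fun j => (w j - s * β j p) • j) t (by simp only [hsi, zero_smul])]
    simp_rw [sub_smul, Finset.sum_sub_distrib, mul_smul, ← Finset.smul_sum]
    rw [hwx, h2]
  have hpe : p ∉ t.erase i := fun h => hpt (Finset.mem_of_mem_erase h)
  set v : Pt → ℝ := fun j => if j = p then s else w j - s * β j p with hv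
  have hve : ∀ j ∈ t.erase i, v j = w j - s * β j p := fun j hj => by
    rw [hv]
    exact if_neg fun h : j = p => hpe (h ▸ hj)
  have hvp : v p = s := if_pos rfl
  have hv1 : ∑ j ∈ insert p (t.erase i), v j = 1 := by
    rw [Finset.sum_insert hpe, Finset.sum_congr rfl hve, hvp, hsum1]
    ring
  have hv2 : ∑ j ∈ insert p (t.erase i), v j • j = x := by
    rw [Finset.sum_insert hpe, Finset.sum_congr rfl fun j hj => by rw [hve j hj], hvp, hsum2]
    abel
  refine ⟨i, hit, ?_, hpt, fun g hg => ?_⟩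
  · refine Finset.mem_convexHull'.2 ⟨v, fun j hj => ?_, hv1, hv2⟩
    rcases Finset.mem_insert.1 hj with rfl | hj
    · rw [hvp]; exact hs0.le
    · rw [hve j hj]; exact hnn j (Finset.mem_of_mem_erase hj)
  · rw [← hv2, g.map_sum hv1, f.map_sum hv1, Finset.sum_insert hpe, Finset.sum_insert hpe, hvp,
      hg p (by simp)]
    have : ∑ j ∈ t.erase i, v j * g j = ∑ j ∈ t.erase i, v j * f j :=
      Finset.sum_congr rfl fun j hj => by
        rw [hg j (Finset.mem_insert_of_mem hj), hf j (Finset.mem_of_mem_erase hj)]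
    rw [this]
    have := mul_lt_mul_of_pos_left hp hs0
    linarith

lemma IsDel.tri {Q : Set Pt} (hQ : GenPos Q) {t : Finset Pt} (ht : IsDel Q t) : Tri t :=
  hQ.tri ht.1 ht.2.1

lemma IsDel.nonempty {Q : Set Pt} {t : Finset Pt} (ht : IsDel Q t) : t.Nonempty :=
  Finset.card_pos.1 (by rw [ht.1]; norm_num)

lemma finite_finsets {Q : Set Pt} (hQ : Q.Finite) : {t : Finset Pt | (t : Set Pt) ⊆ Q}.Finite := by
  refine (Finset.finite_toSet hQ.toFinset.powerset).subset fun t ht => ?_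
  simpa using ht

lemma finite_isDel {Q : Set Pt} (hQ : Q.Finite) : {t | IsDel Q t}.Finite :=
  (finite_finsets hQ).subset fun _ ht => ht.2.1

lemma Generic.exists_isDel {Q : Set Pt} (hfin : Q.Finite) (hQ : GenPos Q) (hnt : Q.Nontrivial)
    {x : Pt} (hx : x ∈ Generic Q) (hxQ : x ∈ convexHull ℝ Q) :
    ∃ t, IsDel Q t ∧ x ∈ openHull t := by
  have hL : ∀ t : Finset Pt, ∃ f : AffFn, Tri t → ∀ i ∈ t, f i = sqn i := fun t => by
    by_cases ht : Tri t
    · obtain ⟨f, hf⟩ := ht.exists_interp sqn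
      exact ⟨f, fun _ => hf⟩
    · exact ⟨0, fun h => absurd h ht⟩
  choose L hL using hL
  have hS : {t : Finset Pt | t.card = 3 ∧ (t : Set Pt) ⊆ Q ∧ x ∈ triSet t}.Finite :=
    (finite_finsets hfin).subset fun t ht => ht.2.1
  obtain ⟨t, ⟨ht3, htQ, hxt⟩, hmin⟩ := exists_min_image _ (fun t => L t x) hS
    (Generic.exists_triangle hx hnt hxQ)
  have htri := hQ.tri ht3 htQ
  have hxo := Generic.mem_openHull hx hnt ht3 htQ hxt
  refine ⟨t, ⟨ht3, htQ, L t, hL t htri, fun p hp => ?_⟩, hxo⟩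
  by_contra! hlt
  obtain ⟨i, hi, hx', hpt, hg⟩ := exists_exchange htri (hL t htri) hlt hxo
  have h3 : (insert p (t.erase i)).card = 3 := by
    rw [Finset.card_insert_of_notMem (fun h => hpt (Finset.mem_of_mem_erase h)),
      Finset.card_erase_of_mem hi, ht3]
  have hsub : ((insert p (t.erase i) : Finset Pt) : Set Pt) ⊆ Q := by
    rw [Finset.coe_insert, insert_subset_iff]
    exact ⟨hp, (Finset.coe_subset.2 (Finset.erase_subset _ _)).trans htQ⟩
  have h1 := hmin _ ⟨h3, hsub, hx'⟩
  have h2 := hg _ (hL _ (hQ.tri h3 hsub))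
  exact absurd h2 (not_lt.2 h1)

lemma subset_of_closed_of_generic {Q : Set Pt} (hfin : Q.Finite) {U C : Set Pt} (hU : IsOpen U)
    (hC : IsClosed C) (h : ∀ x ∈ U, x ∈ Generic Q → x ∈ C) : U ⊆ C := by
  intro x hx
  by_contra hxC
  obtain ⟨y, ⟨hyU, hyC⟩, hy⟩ := exists_generic hfin (hU.inter hC.isOpen_compl) ⟨x, hx, hxC⟩
  exact hyC (h y hyU hy)

lemma convexHull_subset_closure_interior {Q : Set Pt} {t : Finset Pt} (ht : Tri t)
    (htQ : (t : Set Pt) ⊆ Q) : convexHull ℝ Q ⊆ closure (interior (convexHull ℝ Q)) := by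
  have hne : (interior (convexHull ℝ Q)).Nonempty := by
    refine Nonempty.mono (interior_mono (convexHull_mono htQ)) ?_
    exact ht.interior_eq ▸ ht.openHull_nonempty
  rw [(convex_convexHull ℝ _).closure_interior_eq_closure_of_nonempty_interior hne]
  exact subset_closure

lemma Finset.nontrivial_of_three {Q : Set Pt} {t : Finset Pt} (ht : t.card = 3)
    (htQ : (t : Set Pt) ⊆ Q) : Q.Nontrivial := by
  have : t.Nontrivial := Finset.one_lt_card_iff_nontrivial.1 (by omega)
  exact (Finset.nontrivial_coe.2 this).mono htQ

lemma isClosed_biUnion_triSet {S : Set (Finset Pt)} (hS : S.Finite) :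
    IsClosed (⋃ t ∈ S, triSet t) :=
  hS.isClosed_biUnion fun t _ => isClosed_triSet t

/-- The Delaunay triangles cover the convex hull. -/
lemma exists_isDel_mem {Q : Set Pt} (hfin : Q.Finite) (hQ : GenPos Q) {t : Finset Pt}
    (ht : t.card = 3) (htQ : (t : Set Pt) ⊆ Q) {x : Pt} (hx : x ∈ convexHull ℝ Q) :
    ∃ s, IsDel Q s ∧ x ∈ triSet s := by
  have hnt := Finset.nontrivial_of_three ht htQ
  have hcl := isClosed_biUnion_triSet (finite_isDel hfin)
  have h : interior (convexHull ℝ Q) ⊆ ⋃ s ∈ {s | IsDel Q s}, triSet s := by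
    refine subset_of_closed_of_generic hfin isOpen_interior hcl fun y hy hyg => ?_
    obtain ⟨s, hs, hys⟩ := Generic.exists_isDel hfin hQ hnt hyg (interior_subset hy)
    exact mem_biUnion (x := s) hs (openHull_subset_triSet _ hys)
  have := (convexHull_subset_closure_interior (hQ.tri ht htQ) htQ).trans
    (closure_minimal h hcl) hx
  simpa using this

lemma IsDel.subset_of_meet {Q : Set Pt} (hQ : GenPos Q) {s B : Finset Pt} (hs : IsDel Q s)
    (hBQ : (B : Set Pt) ⊆ Q) {f : AffFn} (hf : ∀ i ∈ B, f i = sqn i) (hf' : ∀ i ∈ s, f i ≤ sqn i)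
    {z : Pt} (hzs : z ∈ triSet s) (hzB : z ∈ openHull B) : B ⊆ s := by
  obtain ⟨h3, hsQ, g, hg, hg'⟩ := hs
  intro i hi
  exact hQ.mem_of_eq h3 hsQ hg (hBQ hi)
    (compat hg hf (fun j hj => hg' j (hBQ hj)) hf' hzs hzB i hi)

lemma IsDel.eq_of_meet {Q : Set Pt} (hQ : GenPos Q) {s t : Finset Pt} (hs : IsDel Q s)
    (ht : IsDel Q t) {z : Pt} (hzs : z ∈ triSet s) (hzt : z ∈ openHull t) : s = t := by
  obtain ⟨h3, htQ, f, hf, hf'⟩ := ht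
  exact (Finset.eq_of_subset_of_card_le
    (hs.subset_of_meet hQ htQ hf (fun i hi => hf' i (hs.2.1 hi)) hzs hzt) (by rw [h3, hs.1])).symm

/-- A subset of a Delaunay triangle whose open hull meets another Delaunay triangle is a
common face. -/
lemma IsDel.face_subset {Q : Set Pt} (hQ : GenPos Q) {s t B : Finset Pt} (hs : IsDel Q s)
    (ht : IsDel Q t) (hBt : B ⊆ t) {z : Pt} (hzs : z ∈ triSet s) (hzB : z ∈ openHull B) :
    B ⊆ s := by
  obtain ⟨h3, htQ, f, hf, hf'⟩ := ht
  exact hs.subset_of_meet hQ (fun i hi => htQ (hBt hi)) (fun i hi => hf i (hBt hi))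
    (fun i hi => hf' i (hs.2.1 hi)) hzs hzB

lemma IsDel.mem_of_mem_triSet {Q : Set Pt} (hQ : GenPos Q) {s : Finset Pt} (hs : IsDel Q s)
    {p : Pt} (hp : p ∈ Q) (hps : p ∈ triSet s) : p ∈ s := by
  obtain ⟨h3, hsQ, g, hg, hg'⟩ := hs
  exact hQ.mem_of_eq h3 hsQ hg hp (le_antisymm (hg' p hp)
    (sqn_le_of_mem_triSet (fun i hi => (hg i hi).ge) hps))

lemma exists_cross {h : AffFn} {a b : Pt} (ha : 0 < h a) (hb : h b < 0) :
    ∃ z ∈ openSegment ℝ a b, h z = 0 := by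
  have hd : 0 < h a - h b := by linarith
  have h1 : -h b / (h a - h b) + h a / (h a - h b) = 1 := by field_simp; ring
  refine ⟨(-h b / (h a - h b)) • a + (h a / (h a - h b)) • b,
    ⟨_, _, div_pos (by linarith) hd, div_pos ha hd, h1, rfl⟩, ?_⟩
  rw [h.map_comb h1]
  field_simp
  ring

lemma AffFn.eq_zero_of_openSegment {h : AffFn} {a b z : Pt} (ha : h a = 0) (hb : h b = 0)
    (hz : z ∈ openSegment ℝ a b) : h z = 0 := by
  obtain ⟨x, y, -, -, hxy, rfl⟩ := hz
  rw [h.map_comb hxy, ha, hb]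
  ring

lemma hgt_openSegment {u v z : Pt} (hz : z ∈ openSegment ℝ u v) : hgt u v z = 0 :=
  AffFn.eq_zero_of_openSegment (hgt_left u v) (hgt_right u v) hz

lemma left_notMem_openSegment {u v : Pt} (h : u ≠ v) : u ∉ openSegment ℝ u v := fun hu =>
  h (left_mem_openSegment_iff.1 hu)

lemma right_notMem_openSegment {u v : Pt} (h : u ≠ v) : v ∉ openSegment ℝ u v := fun hu =>
  h (right_mem_openSegment_iff.1 hu)

/-- A line meets a disk in an interval; if the interval meets the open segment `u v` and
`u`, `v` are not interior to the disk then the interval lies in the segment. -/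
lemma chord {f : AffFn} {u v x z : Pt} (huv : u ≠ v) (hu : f u ≤ sqn u) (hv : f v ≤ sqn v)
    (hx : x ∈ openSegment ℝ u v) (hxf : sqn x ≤ f x) (hz : hgt u v z = 0) (hzf : sqn z ≤ f z) :
    z ∈ openSegment ℝ u v ∨ z = u ∨ z = v := by
  obtain ⟨r, rfl⟩ := exists_of_hgt_eq_zero huv hz
  obtain ⟨s', s, hs', hs, hss, rfl⟩ := hx
  obtain rfl : s' = 1 - s := by linarith
  rcases lt_trichotomy r 0 with hr | rfl | hr
  · exfalso
    have hmem : u ∈ openSegment ℝ ((1 - r) • u + r • v) ((1 - s) • u + s • v) := by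
      have hd : 0 < s - r := by linarith
      refine ⟨s / (s - r), -r / (s - r), div_pos hs hd, div_pos (by linarith) hd, ?_, ?_⟩
      · field_simp; ring
      · match_scalars <;> (field_simp; ring)
    refine absurd (sqn_lt_of_openSegment hzf hxf (fun h => ?_) hmem) (not_lt.2 hu)
    have h2 : (s - r) • (v - u) = 0 := by
      have h3 : (s - r) • (v - u) = ((1 - s) • u + s • v) - ((1 - r) • u + r • v) := by module
      rw [h3, h, sub_self]
    rcases smul_eq_zero.1 h2 with h3 | h3
    · linarith
    · exact huv (sub_eq_zero.1 h3).symm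
  · right; left; simp
  rcases lt_trichotomy r 1 with hr1 | rfl | hr1
  · left
    exact ⟨1 - r, r, by linarith, hr, by ring, rfl⟩
  · right; right; simp
  · exfalso
    have hmem : v ∈ openSegment ℝ ((1 - r) • u + r • v) ((1 - s) • u + s • v) := by
      have hd : 0 < r - s := by linarith
      refine ⟨(1 - s) / (r - s), (r - 1) / (r - s), div_pos (by linarith) hd,
        div_pos (by linarith) hd, ?_, ?_⟩
      · field_simp; ring
      · match_scalars <;> (field_simp; ring)
    refine absurd (sqn_lt_of_openSegment hzf hxf (fun h => ?_) hmem) (not_lt.2 hv)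
    have h2 : (s - r) • (v - u) = 0 := by
      have h3 : (s - r) • (v - u) = ((1 - s) • u + s • v) - ((1 - r) • u + r • v) := by module
      rw [h3, h, sub_self]
    rcases smul_eq_zero.1 h2 with h3 | h3
    · linarith
    · exact huv (sub_eq_zero.1 h3).symm

lemma chord_lt {f : AffFn} {u v x z : Pt} (huv : u ≠ v) (hu : f u ≤ sqn u) (hv : f v ≤ sqn v)
    (hx : x ∈ openSegment ℝ u v) (hxf : sqn x ≤ f x) (hz : hgt u v z = 0) (hzf : sqn z < f z) :
    z ∈ openSegment ℝ u v := by
  rcases chord huv hu hv hx hxf hz hzf.le with h | rfl | rfl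
  · exact h
  · exact absurd hzf (not_lt.2 hu)
  · exact absurd hzf (not_lt.2 hv)

/-- A finite closed cover of a segment has a member containing an initial subsegment. -/
lemma exists_directional {T : Set (Finset Pt)} (hT : T.Finite) {C : Set Pt} (hC : Convex ℝ C)
    (hcov : C ⊆ ⋃ t ∈ T, triSet t) {x y : Pt} (hx : x ∈ C) (hy : y ∈ C) :
    ∃ t ∈ T, ∃ ε : ℝ, 0 < ε ∧ ε ≤ 1 ∧ x ∈ triSet t ∧ (1 - ε) • x + ε • y ∈ triSet t := by
  by_contra! hcon
  have hcont : Continuous fun r : ℝ => (1 - r) • x + r • y := by fun_prop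
  have h1 : ∀ t ∈ T, ∀ᶠ r : ℝ in nhdsWithin 0 (Ioi 0), (1 - r) • x + r • y ∉ triSet t := by
    intro t ht
    by_cases hxt : x ∈ triSet t
    · filter_upwards [Ioc_mem_nhdsGT (zero_lt_one' ℝ)] with r hr
      exact hcon t ht r hr.1 hr.2 hxt
    · refine Filter.Eventually.filter_mono nhdsWithin_le_nhds ?_
      refine hcont.continuousAt.eventually_mem ((isClosed_triSet t).isOpen_compl.mem_nhds ?_)
      simpa using hxt
  have h2 := (Filter.eventually_all_finite hT).2 h1
  obtain ⟨r, hr, hr01⟩ := (h2.and (Ioc_mem_nhdsGT (zero_lt_one' ℝ))).exists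
  have := hcov (hC hx hy (by linarith [hr01.2] : 0 ≤ 1 - r) hr01.1.le (by ring))
  simp only [mem_iUnion] at this
  obtain ⟨t, ht, h⟩ := this
  exact hr t ht h

lemma IsTriangulation.eq_of_meet {P : Set Pt} {T : Set (Finset Pt)} (hP : GenPos P)
    (hT : IsTriangulation P T) {t s : Finset Pt} (ht : t ∈ T) (hs : s ∈ T) {y : Pt}
    (hyt : y ∈ openHull t) (hys : y ∈ triSet s) : t = s := by
  by_contra hne
  have htri := hP.tri (hT.2.1 t ht).1 (hT.2.1 t ht).2
  have hstri := hP.tri (hT.2.1 s hs).1 (hT.2.1 s hs).2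
  rw [← htri.interior_eq] at hyt
  obtain ⟨z, hz⟩ := mem_closure_iff.1 (hstri.triSet_subset_closure hys) _ isOpen_interior hyt
  have := hT.2.2.2.1 ht hs hne
  exact (this ▸ hz : z ∈ (∅ : Set Pt))

lemma IsTriangulation.mem_of_mem_triSet {P : Set Pt} {T : Set (Finset Pt)} (hP : GenPos P)
    (hT : IsTriangulation P T) {t : Finset Pt} (ht : t ∈ T) {p : Pt} (hp : p ∈ P)
    (hpt : p ∈ triSet t) : p ∈ t := by
  by_contra hn
  obtain ⟨ht3, htP⟩ := hT.2.1 t ht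
  have hg : p ∈ Generic (t : Set Pt) := fun a ha b hb hab =>
    hP.hgt_ne (htP ha) (htP hb) hp hab (fun h => hn (h ▸ ha)) (fun h => hn (h ▸ hb))
  have ho := Generic.mem_openHull hg (Finset.nontrivial_of_three ht3 subset_rfl) ht3 subset_rfl hpt
  obtain ⟨s, hs, hps⟩ := hT.2.2.1 p hp
  rw [hT.eq_of_meet hP ht hs ho (mem_triSet hps)] at hn
  exact hn hps

lemma Finset.exists_third {t : Finset Pt} (ht : t.card = 3) {a b : Pt} (ha : a ∈ t) (hb : b ∈ t)
    (hab : a ≠ b) : ∃ c, c ≠ a ∧ c ≠ b ∧ t = {a, b, c} := by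
  have h1 : ((t.erase a).erase b).card = 1 := by
    rw [Finset.card_erase_of_mem (Finset.mem_erase.2 ⟨hab.symm, hb⟩),
      Finset.card_erase_of_mem ha, ht]
  obtain ⟨c, hc⟩ := Finset.card_eq_one.1 h1
  have hc' : c ∈ (t.erase a).erase b := by rw [hc]; simp
  simp only [Finset.mem_erase] at hc'
  refine ⟨c, hc'.2.1, hc'.1, ?_⟩
  rw [← Finset.insert_erase ha, ← Finset.insert_erase (Finset.mem_erase.2 ⟨hab.symm, hb⟩), hc]

lemma GenPos.eq_of_hgt {P : Set Pt} (hP : GenPos P) {u v p : Pt} (hu : u ∈ P) (hv : v ∈ P)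
    (huv : u ≠ v) (hp : p ∈ P) (h : hgt u v p = 0) : p = u ∨ p = v := by
  by_contra! hn
  exact hP.hgt_ne hu hv hp huv hn.1.symm hn.2.symm h

lemma sum_three {M : Type*} [AddCommMonoid M] {a b c : Pt} (hab : a ≠ b) (hca : c ≠ a)
    (hcb : c ≠ b) (F : Pt → M) : ∑ i ∈ ({a, b, c} : Finset Pt), F i = F a + F b + F c := by
  rw [Finset.sum_insert (by simp [hab, hca.symm]), Finset.sum_pair hcb.symm, add_assoc]

lemma IsTriangulation.not_cross {P : Set Pt} {T : Set (Finset Pt)} (hP : GenPos P)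
    (hT : IsTriangulation P T) {t s : Finset Pt} (ht : t ∈ T) (hs : s ∈ T) {w q u v y : Pt}
    (hw : w ∈ t) (hq : q ∈ t) (hu : u ∈ s) (hv : v ∈ s) (huv : u ≠ v) (hwuv : hgt u v w ≠ 0)
    (hy : y ∈ openSegment ℝ w q) (hy' : y ∈ openSegment ℝ u v) : False := by
  have hyh := hgt_openSegment hy'
  have hwq : w ≠ q := by
    rintro rfl
    rw [openSegment_same, mem_singleton_iff] at hy
    exact hwuv (hy ▸ hyh)
  have hqh : hgt u v q ≠ 0 := by
    intro h
    obtain ⟨a, b, ha, hb, hab, rfl⟩ := hy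
    rw [(hgt u v).map_comb hab, h] at hyh
    simp [ha.ne', hwuv] at hyh
  obtain ⟨ht3, htP⟩ := hT.2.1 t ht
  obtain ⟨hs3, hsP⟩ := hT.2.1 s hs
  have huw : u ≠ w := fun h => hwuv (h ▸ hgt_left u v)
  have huq : u ≠ q := fun h => hqh (h ▸ hgt_left u v)
  have hvw : v ≠ w := fun h => hwuv (h ▸ hgt_right u v)
  have hvq : v ≠ q := fun h => hqh (h ▸ hgt_right u v)
  have hts : t ≠ s := by
    rintro rfl
    have : ({u, v, w, q} : Finset Pt) ⊆ t := by
      simp [Finset.insert_subset_iff, hu, hv, hw, hq]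
    have h2 := Finset.card_le_card this
    rw [ht3, Finset.card_insert_of_notMem, Finset.card_insert_of_notMem, Finset.card_pair hwq] at h2
    · omega
    · simp [hvw, hvq]
    · simp [huv, huw, huq]
  obtain ⟨r, hrw, hrq, rfl⟩ := Finset.exists_third ht3 hw hq hwq
  obtain ⟨β, h1, h2, h3, h4, h5⟩ := (hP.tri ht3 htP).exists_bary
  have hr : r ∈ ({w, q, r} : Finset Pt) := by simp
  have hyb : β r y = 0 := AffFn.eq_zero_of_openSegment (by rw [h3 r hr w hw, if_neg hrw])
    (by rw [h3 r hr q hq, if_neg hrq]) hy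
  have key : ∀ x ∈ P, 0 < β r x → x ∈ triSet s → False := by
    intro x hx hpos hxs
    have hcont : Continuous fun ε : ℝ => (1 - ε) • y + ε • x := by fun_prop
    have hpw : 0 < β w y := by
      obtain ⟨a, b, ha, hb, hab, rfl⟩ := hy
      rw [(β w).map_comb hab, h3 w hw w hw, h3 w hw q hq, if_neg hwq]
      simpa using ha
    have hpq : 0 < β q y := by
      obtain ⟨a, b, ha, hb, hab, rfl⟩ := hy
      rw [(β q).map_comb hab, h3 q hq w hw, h3 q hq q hq, if_neg hwq.symm]
      simpa using hb
    have hopen : IsOpen {z | 0 < β w z ∧ 0 < β q z} :=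
      (isOpen_lt continuous_const (β w).continuous).inter
        (isOpen_lt continuous_const (β q).continuous)
    have hev : ∀ᶠ ε : ℝ in nhdsWithin 0 (Ioi 0),
        0 < β w ((1 - ε) • y + ε • x) ∧ 0 < β q ((1 - ε) • y + ε • x) := by
      refine Filter.Eventually.filter_mono nhdsWithin_le_nhds ?_
      refine hcont.continuousAt.eventually_mem (hopen.mem_nhds ?_)
      simpa using ⟨hpw, hpq⟩
    obtain ⟨ε, ⟨hεw, hεq⟩, hε⟩ := (hev.and (Ioc_mem_nhdsGT (zero_lt_one' ℝ))).exists
    refine hts (hT.eq_of_meet hP ht hs (y := (1 - ε) • y + ε • x) ?_ ?_)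
    · rw [← (hP.tri ht3 htP).interior_eq, h4]
      intro i hi
      simp only [Finset.mem_insert, Finset.mem_singleton] at hi
      rcases hi with rfl | rfl | rfl
      · exact hεw
      · exact hεq
      · rw [(β i).map_comb (by ring), hyb, mul_zero, zero_add]
        exact mul_pos hε.1 hpos
    · refine (convex_convexHull ℝ _) ?_ hxs (by linarith [hε.2]) hε.1.le (by ring)
      exact segment_subset_triSet (mem_triSet hu) (mem_triSet hv)
        (openSegment_subset_segment _ _ _ hy')
  have hnu := not_lt.1 fun h => key u (hsP hu) h (mem_triSet hu)
  have hnv := not_lt.1 fun h => key v (hsP hv) h (mem_triSet hv)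
  have hu0 : β r u = 0 ∧ β r v = 0 := by
    obtain ⟨a, b, ha, hb, hab, rfl⟩ := hy'
    rw [(β r).map_comb hab] at hyb
    have := mul_nonpos_of_nonneg_of_nonpos ha.le hnu
    have := mul_nonpos_of_nonneg_of_nonpos hb.le hnv
    constructor
    · exact (mul_eq_zero.1 (by linarith : a * β r u = 0)).resolve_left ha.ne'
    · exact (mul_eq_zero.1 (by linarith : b * β r v = 0)).resolve_left hb.ne'
  have hline : ∀ x, β r x = 0 → hgt w q x = 0 := by
    intro x hx
    have e := h2 x
    have e1 := h1 x
    rw [sum_three hwq hrw hrq, hx] at e e1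
    rw [zero_smul] at e
    rw [← e, add_zero, (hgt w q).map_comb (by linarith), hgt_left, hgt_right]
    ring
  rcases hP.eq_of_hgt (htP hw) (htP hq) hwq (hsP hu) (hline u hu0.1) with h | h
  · exact huw h
  · exact huq h

/-- `g` is the plane of the circle through `u`, `v` that is empty above the line `u v` and
touches a point there; its disk contains at most `k` points of `P`. -/
def Cap (P : Set Pt) (k : ℕ) (u v : Pt) (g : AffFn) : Prop :=
  g u = sqn u ∧ g v = sqn v ∧ (∀ p ∈ P, 0 ≤ hgt u v p → g p ≤ sqn p) ∧
  {p ∈ P | sqn p < g p}.encard ≤ (k : ℕ∞) ∧ ∃ w ∈ P, 0 < hgt u v w ∧ g w = sqn w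

lemma exists_touching {P : Set Pt} (hfin : P.Finite) (hP : GenPos P) {u v c : Pt} (hu : u ∈ P)
    (hv : v ∈ P) (huv : u ≠ v) (hc : c ∈ P) (hcpos : 0 < hgt u v c) :
    ∃ g : AffFn, g u = sqn u ∧ g v = sqn v ∧ (∀ p ∈ P, 0 ≤ hgt u v p → g p ≤ sqn p) ∧
      ∃ w ∈ P, 0 < hgt u v w ∧ g w = sqn w := by
  have hcu : c ≠ u := by rintro rfl; rw [hgt_left] at hcpos; exact lt_irrefl _ hcpos
  have hcv : c ≠ v := by rintro rfl; rw [hgt_right] at hcpos; exact lt_irrefl _ hcpos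
  have htri : Tri {u, v, c} := by
    refine hP.tri ?_ ?_
    · rw [Finset.card_eq_three]
      exact ⟨u, v, c, huv, hcu.symm, hcv.symm, rfl⟩
    · simp [insert_subset_iff, hu, hv, hc]
  obtain ⟨g0, hg0⟩ := htri.exists_interp sqn
  obtain ⟨w, ⟨hw, hwpos⟩, hmin⟩ := exists_min_image {p ∈ P | 0 < hgt u v p}
    (fun p => (sqn p - g0 p) / hgt u v p) (hfin.subset fun p hp => hp.1) ⟨c, hc, hcpos⟩
  set s := (sqn w - g0 w) / hgt u v w with hs
  have happ : ∀ p, (g0 + s • hgt u v : AffFn) p = g0 p + s * hgt u v p := fun p => rfl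
  have hgu : (g0 + s • hgt u v : AffFn) u = sqn u := by
    rw [happ, hg0 u (by simp), hgt_left]; ring
  have hgv : (g0 + s • hgt u v : AffFn) v = sqn v := by
    rw [happ, hg0 v (by simp), hgt_right]; ring
  refine ⟨g0 + s • hgt u v, hgu, hgv, fun p hp hp0 => ?_, w, hw, hwpos, ?_⟩
  · rcases hp0.eq_or_lt with h0 | hpos
    · rcases hP.eq_of_hgt hu hv huv hp h0.symm with rfl | rfl
      · exact hgu.le
      · exact hgv.le
    · have := hmin p ⟨hp, hpos⟩
      rw [le_div_iff₀ hpos] at this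
      rw [happ]
      linarith
  · rw [happ, hs]
    field_simp
    ring

lemma sqn_le_of_mem_openSegment {g : AffFn} {u v x : Pt} (hu : g u = sqn u) (hv : g v = sqn v)
    (huv : u ≠ v) (hx : x ∈ openSegment ℝ u v) : sqn x < g x :=
  sqn_lt_of_openSegment hu.ge hv.ge huv hx

/-- In a triangulation with `u v` as an edge, no edge from a vertex `w` of the touching circle
points from `w` into the open segment `u v`. -/
lemma IsTriangulation.not_toward {P : Set Pt} {T : Set (Finset Pt)} (hP : GenPos P)
    (hT : IsTriangulation P T) {t s : Finset Pt} (ht : t ∈ T) (hs : s ∈ T) {w q u v : Pt}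
    (hw : w ∈ t) (hq : q ∈ t) (hu : u ∈ s) (hv : v ∈ s) (huv : u ≠ v) (hwpos : 0 < hgt u v w)
    {g : AffFn} (hgu : g u = sqn u) (hgv : g v = sqn v) (hgw : g w = sqn w)
    (hg : ∀ p ∈ P, 0 ≤ hgt u v p → g p ≤ sqn p) {c : ℝ} (hc : 0 < c)
    (hy : (1 - c) • w + c • q ∈ openSegment ℝ u v) : False := by
  have huP := (hT.2.1 s hs).2 hu
  have hvP := (hT.2.1 s hs).2 hv
  have hqP := (hT.2.1 t ht).2 hq
  have hyh := hgt_openSegment hy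
  rw [(hgt u v).map_comb (by ring)] at hyh
  rcases lt_trichotomy c 1 with h1 | rfl | h1
  · exact hT.not_cross hP ht hs hw hq hu hv huv hwpos.ne'
      ⟨1 - c, c, by linarith, hc, by ring, rfl⟩ hy
  · simp only [sub_self, zero_smul, one_smul, zero_add] at hy
    rcases hP.eq_of_hgt huP hvP huv hqP (hgt_openSegment hy) with rfl | rfl
    · exact left_notMem_openSegment huv hy
    · exact right_notMem_openSegment huv hy
  · have hqpos : 0 < hgt u v q := by nlinarith
    have hylt := sqn_le_of_mem_openSegment hgu hgv huv hy
    refine absurd (sqn_lt_of_openSegment' hylt hgw.ge (z := q) ?_) (not_lt.2 (hg q hqP hqpos.le))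
    have hc0 : c ≠ 0 := hc.ne'
    refine ⟨1 / c, 1 - 1 / c, by positivity, ?_, by ring, ?_⟩
    · rw [sub_pos, div_lt_one hc]; exact h1
    · match_scalars <;> field_simp
      ring

lemma exists_cap {P : Set Pt} (hfin : P.Finite) (hP : GenPos P) {k : ℕ} {u v c : Pt} (hu : u ∈ P)
    (hv : v ∈ P) (huv : u ≠ v) (hc : c ∈ P) (hcpos : 0 < hgt u v c) (hk : UsefulEdge P k u v) :
    ∃ g, Cap P k u v g := by
  obtain ⟨g, hgu, hgv, hg, w, hw, hwpos, hgw⟩ := exists_touching hfin hP hu hv huv hc hcpos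
  refine ⟨g, hgu, hgv, hg, ?_, w, hw, hwpos, hgw⟩
  obtain ⟨T, ⟨hT, hord⟩, s, hs, hus, hvs⟩ := hk
  set x := (1 / 2 : ℝ) • u + (1 / 2 : ℝ) • v with hx
  have hxuv : x ∈ openSegment ℝ u v := ⟨1 / 2, 1 / 2, by norm_num, by norm_num, by norm_num, rfl⟩
  have hxP : x ∈ convexHull ℝ P := (convex_convexHull ℝ P).segment_subset
    (subset_convexHull ℝ P hu) (subset_convexHull ℝ P hv) (openSegment_subset_segment _ _ _ hxuv)
  obtain ⟨t, ht, ε, hε0, hε1, hwt, hyt⟩ := exists_directional hT.1 (convex_convexHull ℝ P)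
    hT.2.2.2.2.ge (subset_convexHull ℝ P hw) hxP
  replace hwt := hT.mem_of_mem_triSet hP ht hw hwt
  obtain ⟨ht3, htP⟩ := hT.2.1 t ht
  obtain ⟨f, hf, hfk⟩ := (hord t ht).exists_affFn ⟨w, hwt⟩
  refine (encard_le_encard ?_).trans hfk
  obtain ⟨β, h1, h2, h3, h4, h5⟩ := (hP.tri ht3 htP).exists_bary
  obtain ⟨p, hp, hpw⟩ : ∃ p ∈ t, p ≠ w := by
    obtain ⟨p, hp⟩ := Finset.exists_mem_ne (by omega : 1 < t.card) w
    exact ⟨p, hp⟩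
  obtain ⟨q, hqw, hqp, rfl⟩ := Finset.exists_third ht3 hwt hp hpw.symm
  have hq : q ∈ ({w, p, q} : Finset Pt) := by simp
  have hnt : ∀ i ∈ ({w, p, q} : Finset Pt), ∀ c : ℝ, 0 < c →
      (1 - c) • w + c • i ∉ openSegment ℝ u v := fun i hi c hc hy =>
    hT.not_toward hP ht hs hwt hi hus hvs huv hwpos hgu hgv hgw hg hc hy
  -- the circle through `t` dominates the touching circle at its vertices
  have hψ : ∀ i ∈ ({w, p, q} : Finset Pt), g i ≤ f i := by
    intro i hi
    rw [hf i hi]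
    by_contra! hlt
    have hneg : hgt u v i < 0 := by
      by_contra! h
      exact absurd hlt (not_lt.2 (hg i (htP hi) h))
    obtain ⟨z, hz, hz0⟩ := exists_cross hwpos hneg
    have hzlt : sqn z < g z := sqn_lt_of_openSegment' hlt hgw.ge (openSegment_symm ℝ w i ▸ hz)
    have hzuv := chord_lt huv hgu.le hgv.le hxuv
      (sqn_le_of_mem_openSegment hgu hgv huv hxuv).le hz0 hzlt
    obtain ⟨a, b, ha, hb, hab, rfl⟩ := hz
    obtain rfl : a = 1 - b := by linarith
    exact hnt i hi b hb hzuv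
  have hdec : ∀ y, y = (1 - β p y - β q y) • w + β p y • p + β q y • q := by
    intro y
    have e := h2 y
    have e1 := h1 y
    rw [sum_three hpw.symm hqw hqp] at e e1
    have : β w y = 1 - β p y - β q y := by linarith
    rw [this] at e
    exact e.symm
  have hcone : openSegment ℝ u v ⊆ {y | 0 < β p y ∧ 0 < β q y} := by
    have hpre : IsPreconnected (openSegment ℝ u v) := (convex_openSegment u v).isPreconnected
    have ho1 : IsOpen {y | 0 < β p y ∧ 0 < β q y} :=
      (isOpen_lt continuous_const (β p).continuous).inter
        (isOpen_lt continuous_const (β q).continuous)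
    have ho2 : IsOpen {y | β p y < 0 ∨ β q y < 0} :=
      (isOpen_lt (β p).continuous continuous_const).union
        (isOpen_lt (β q).continuous continuous_const)
    have hbd : ∀ y ∈ openSegment ℝ u v, (β p y = 0 → 0 ≤ β q y → False) ∧
        (β q y = 0 → 0 ≤ β p y → False) := by
      have hw' : w ∉ openSegment ℝ u v := fun h => hwpos.ne' (hgt_openSegment h)
      intro y hy
      constructor
      · intro e h
        have hd := hdec y
        rw [e, sub_zero, zero_smul, add_zero] at hd
        rcases h.eq_or_lt with h | h
        · rw [← h] at hd
          simp only [sub_zero, one_smul, zero_smul, add_zero] at hd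
          exact hw' (hd ▸ hy)
        · exact hnt q hq _ h (hd ▸ hy)
      · intro e h
        have hd := hdec y
        rw [e, sub_zero, zero_smul, add_zero] at hd
        rcases h.eq_or_lt with h | h
        · rw [← h] at hd
          simp only [sub_zero, one_smul, zero_smul, add_zero] at hd
          exact hw' (hd ▸ hy)
        · exact hnt p hp _ h (hd ▸ hy)
    have hcov : openSegment ℝ u v ⊆ {y | 0 < β p y ∧ 0 < β q y} ∪ {y | β p y < 0 ∨ β q y < 0} := by
      intro y hy
      by_contra hn
      simp only [mem_union, mem_ofPred_eq, not_or, not_and, not_lt] at hn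
      obtain ⟨hn1, hn2, hn3⟩ := hn
      rcases hn2.eq_or_lt with h | h
      · exact (hbd y hy).1 h.symm hn3
      · exact (hbd y hy).2 (le_antisymm (hn1 h) hn3) hn2
    have hxβ : ∀ i ∈ ({w, p, q} : Finset Pt), i ≠ w → 0 ≤ β i x := by
      intro i hi hiw
      rw [h5] at hyt
      have := hyt i hi
      rw [(β i).map_comb (by ring), h3 i hi w hwt, if_neg hiw] at this
      simp only [mul_zero, zero_add] at this
      exact nonneg_of_mul_nonneg_right this hε0
    rcases isPreconnected_iff_subset_of_disjoint.1 hpre _ _ ho1 ho2 hcov (by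
      ext y
      simp only [mem_inter_iff, mem_ofPred_eq, mem_empty_iff_false, iff_false]
      rintro ⟨-, ⟨ha, hb⟩, h | h⟩ <;> linarith) with h | h
    · exact h
    · rcases h hxuv with h | h
      · exact absurd h (not_lt.2 (hxβ p hp hpw))
      · exact absurd h (not_lt.2 (hxβ q hq hqw))
  rintro b ⟨hb, hbg⟩
  refine ⟨hb, ?_⟩
  have hneg : hgt u v b < 0 := by
    by_contra! h
    exact absurd hbg (not_lt.2 (hg b hb h))
  obtain ⟨z, hz, hz0⟩ := exists_cross hwpos hneg
  have hzlt : sqn z < g z := sqn_lt_of_openSegment' hbg hgw.ge (openSegment_symm ℝ w b ▸ hz)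
  have hzuv := chord_lt huv hgu.le hgv.le hxuv
    (sqn_le_of_mem_openSegment hgu hgv huv hxuv).le hz0 hzlt
  obtain ⟨hpz, hqz⟩ := hcone hzuv
  have hψz : g z ≤ f z := by
    have e := hdec z
    have e1 : (1 - β p z - β q z) + β p z + β q z = 1 := by ring
    have e2 := g.map_comb₃ e1 w p q
    have e3 := f.map_comb₃ e1 w p q
    rw [← e] at e2 e3
    have hw1 : g w = f w := by rw [hgw, hf w hwt]
    have := mul_le_mul_of_nonneg_left (hψ p hp) hpz.le
    have := mul_le_mul_of_nonneg_left (hψ q hq) hqz.le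
    rw [e2, e3, hw1]
    linarith
  obtain ⟨a, c', ha, hc', hac, rfl⟩ := hz
  rw [g.map_comb hac, f.map_comb hac, hgw, hf w hwt] at hψz
  have : g b ≤ f b := le_of_mul_le_mul_left (by linarith) hc'
  linarith

/-- `u v` is a pair of points of `P` that is not an edge of the Delaunay triangulation. -/
structure NonDel (P : Set Pt) (u v : Pt) : Prop where
  left : u ∈ P
  right : v ∈ P
  ne : u ≠ v
  notMem : ∀ s, IsDel P s → u ∈ s → v ∉ s

/-- The Delaunay triangles met by the open segment `u v`. -/
def Hull (P : Set Pt) (u v : Pt) (s : Finset Pt) : Prop :=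
  IsDel P s ∧ (openSegment ℝ u v ∩ triSet s).Nonempty

/-- The points of `P` on or above the line `u v`. -/
def above (P : Set Pt) (u v : Pt) : Set Pt := {p ∈ P | 0 ≤ hgt u v p}

/-- Delaunay triangles of the points above `u v` that meet the hull of `u v`. -/
def UpperRetri (P : Set Pt) (u v : Pt) (t : Finset Pt) : Prop :=
  IsDel (above P u v) t ∧ ∃ s, Hull P u v s ∧ (openHull t ∩ triSet s).Nonempty

/-- The retriangulation of the hull of `u v`. -/
def Retri (P : Set Pt) (u v : Pt) (t : Finset Pt) : Prop :=
  UpperRetri P u v t ∨ UpperRetri P v u t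

section

variable {P : Set Pt} {u v : Pt} {s t : Finset Pt}

lemma above_subset : above P u v ⊆ P := fun _ hp => hp.1

lemma NonDel.symm (he : NonDel P u v) : NonDel P v u :=
  ⟨he.right, he.left, he.ne.symm, fun s hs hv hu => he.notMem s hs hu hv⟩

lemma NonDel.left_mem_above (he : NonDel P u v) : u ∈ above P u v :=
  ⟨he.left, (hgt_left u v).ge⟩

lemma NonDel.right_mem_above (he : NonDel P u v) : v ∈ above P u v :=
  ⟨he.right, (hgt_right u v).ge⟩

lemma Hull.symm (hs : Hull P u v s) : Hull P v u s :=
  ⟨hs.1, openSegment_symm ℝ u v ▸ hs.2⟩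

lemma Hull.cross_mem (he : NonDel P u v) (hs : Hull P u v s) {a b z : Pt} (ha : a ∈ triSet s)
    (hb : b ∈ triSet s) (hab : a ≠ b) (hz : z ∈ openSegment ℝ a b) (hz0 : hgt u v z = 0) :
    z ∈ openSegment ℝ u v := by
  obtain ⟨⟨h3, hsP, f, hf, hf'⟩, x, hx, hxs⟩ := hs
  have hdisk : ∀ y ∈ triSet s, sqn y ≤ f y := fun y hy =>
    sqn_le_of_mem_triSet (fun i hi => (hf i hi).ge) hy
  exact chord_lt he.ne (hf' u he.left) (hf' v he.right) hx (hdisk x hxs) hz0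
    (sqn_lt_of_openSegment (hdisk a ha) (hdisk b hb) hab hz)

lemma openHull_empty {z : Pt} : z ∉ openHull ∅ := by
  rintro ⟨w, -, h, -⟩
  simp at h

lemma Hull.exists_pos (hP : GenPos P) (he : NonDel P u v) (hs : Hull P u v s) :
    ∃ a ∈ s, 0 < hgt u v a := by
  by_contra! hcon
  obtain ⟨hd, x, hx, hxs⟩ := hs
  obtain ⟨B, hBs, hxB⟩ := exists_support hxs
  have h0 := AffFn.eq_of_mem_openHull (f := hgt u v) (g := 0) (fun i hi => hcon i (hBs hi)) hxB
    (hgt_openSegment hx).ge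
  have huv : ∀ i ∈ B, i = u ∨ i = v := fun i hi =>
    hP.eq_of_hgt he.left he.right he.ne (hd.2.1 (hBs hi)) (h0 i hi)
  by_cases hu : u ∈ B
  · have hv : v ∉ B := fun hv => he.notMem s hd (hBs hu) (hBs hv)
    have : B = {u} := by
      ext i
      rw [Finset.mem_singleton]
      refine ⟨fun hi => (huv i hi).resolve_right fun h => hv (h ▸ hi), fun h => h ▸ hu⟩
    rw [this] at hxB
    rw [openHull_singleton hxB] at hx
    exact left_notMem_openSegment he.ne hx
  · by_cases hv : v ∈ B
    · have : B = {v} := by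
        ext i
        rw [Finset.mem_singleton]
        refine ⟨fun hi => (huv i hi).resolve_left fun h => hu (h ▸ hi), fun h => h ▸ hv⟩
      rw [this] at hxB
      rw [openHull_singleton hxB] at hx
      exact right_notMem_openSegment he.ne hx
    · have : B = ∅ := by
        refine Finset.eq_empty_of_forall_notMem fun i hi => ?_
        rcases huv i hi with rfl | rfl
        · exact hu hi
        · exact hv hi
      rw [this] at hxB
      exact openHull_empty hxB

lemma Hull.exists_neg (hP : GenPos P) (he : NonDel P u v) (hs : Hull P u v s) :
    ∃ b ∈ s, hgt u v b < 0 := by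
  obtain ⟨b, hb, h⟩ := hs.symm.exists_pos hP he.symm
  rw [hgt_swap] at h
  exact ⟨b, hb, by linarith⟩

lemma half_sum_mem_openSegment (u v : Pt) :
    (1 / 2 : ℝ) • u + (1 / 2 : ℝ) • v ∈ openSegment ℝ u v :=
  ⟨1 / 2, 1 / 2, by norm_num, by norm_num, by norm_num, rfl⟩

lemma exists_hull_meet (hfin : P.Finite) (hP : GenPos P) (huv : u ≠ v) (ht : t.card = 3)
    (htP : (t : Set Pt) ⊆ P) (hu : u ∈ t) (hv : v ∈ t) :
    ∃ s, Hull P u v s ∧ (openHull t ∩ triSet s).Nonempty := by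
  obtain ⟨r, hru, hrv, htr⟩ := Finset.exists_third ht hu hv huv
  have hr : r ∈ t := by rw [htr]; simp
  set x := (1 / 2 : ℝ) • u + (1 / 2 : ℝ) • v with hx
  have hxuv : x ∈ openSegment ℝ u v := half_sum_mem_openSegment u v
  have hxP : x ∈ convexHull ℝ P := (convex_convexHull ℝ P).segment_subset
    (subset_convexHull ℝ P (htP hu)) (subset_convexHull ℝ P (htP hv))
    (openSegment_subset_segment _ _ _ hxuv)
  have hcov : convexHull ℝ P ⊆ ⋃ s ∈ {s | IsDel P s}, triSet s := fun y hy => by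
    simpa using exists_isDel_mem hfin hP ht htP hy
  obtain ⟨s, hs, ε, hε0, hε1, hxs, hys⟩ := exists_directional (finite_isDel hfin)
    (convex_convexHull ℝ P) hcov hxP (subset_convexHull ℝ P (htP hr))
  refine ⟨s, ⟨hs, x, hxuv, hxs⟩, (1 - ε / 2) • x + (ε / 2) • r, ?_, ?_⟩
  · refine ⟨fun i => if i = r then ε / 2 else (1 - ε / 2) / 2, fun i _ => ?_, ?_, ?_⟩
    · dsimp only
      split_ifs <;> linarith
    · rw [htr, sum_three huv hru hrv]
      rw [if_neg hru.symm, if_neg hrv.symm, if_pos rfl]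
      ring
    · rw [htr, sum_three huv hru hrv]
      dsimp only
      rw [if_neg hru.symm, if_neg hrv.symm, if_pos rfl, hx]
      module
  · have := (convex_convexHull ℝ (s : Set Pt)) hxs hys (by norm_num : (0 : ℝ) ≤ 1 / 2)
      (by norm_num : (0 : ℝ) ≤ 1 / 2) (by norm_num)
    have e : (1 - ε / 2) • x + (ε / 2) • r =
        (1 / 2 : ℝ) • x + (1 / 2 : ℝ) • ((1 - ε) • x + ε • r) := by module
    rw [e]
    exact this

lemma UpperRetri.hgt_pos (hP : GenPos P) (he : NonDel P u v) (ht : UpperRetri P u v t) {z : Pt}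
    (hz : z ∈ openHull t) : 0 < hgt u v z := by
  by_contra! hle
  have h0 := AffFn.eq_of_mem_openHull (f := 0) (g := hgt u v) (fun i hi => (ht.1.2.1 hi).2) hz hle
  have hsub : t ⊆ {u, v} := fun i hi => by
    have := hP.eq_of_hgt he.left he.right he.ne (ht.1.2.1 hi).1 (h0 i hi).symm
    simpa using this
  have := Finset.card_le_card hsub
  rw [ht.1.1, Finset.card_pair he.ne] at this
  omega

lemma UpperRetri.ne_of_isDel (hP : GenPos P) (he : NonDel P u v) (ht : UpperRetri P u v t)
    (hs : Hull P u v s) : t ≠ s := by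
  rintro rfl
  obtain ⟨b, hb, hneg⟩ := hs.exists_neg hP he
  exact absurd (ht.1.2.1 hb).2 (not_le.2 hneg)

lemma UpperRetri.orderKTri (hP : GenPos P) (he : NonDel P u v) {k : ℕ} {g : AffFn}
    (hg : Cap P k u v g) (ht : UpperRetri P u v t) : OrderKTri P k t := by
  have hpos := fun z hz => ht.hgt_pos hP he (z := z) hz
  have hneS := fun s hs => ht.ne_of_isDel hP he (s := s) hs
  obtain ⟨hgu, hgv, hgP, hgk, -⟩ := hg
  obtain ⟨⟨h3, htA, f, hf, hf'⟩, s, hs, y, hyt, hys⟩ := ht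
  have hyf : sqn y ≤ f y :=
    sqn_le_of_mem_triSet (fun i hi => (hf i hi).ge) (openHull_subset_triSet _ hyt)
  obtain ⟨b, hb, hbf⟩ : ∃ b ∈ s, sqn b < f b := by
    by_contra! hcon
    refine hneS s hs (Finset.eq_of_subset_of_card_le
      (hs.1.subset_of_meet hP (htA.trans above_subset) hf hcon hys hyt) ?_)
    rw [h3, hs.1.1]
  have hbelow : ∀ p ∈ P, sqn p < f p → hgt u v p < 0 := fun p hp hlt => by
    by_contra! h
    exact absurd hlt (not_lt.2 (hf' p ⟨hp, h⟩))
  have hbP := hs.1.2.1 hb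
  have hb0 := hbelow b hbP hbf
  have hy0 := hpos y hyt
  obtain ⟨z, hz, hz0⟩ := exists_cross hy0 hb0
  have hzuv := hs.cross_mem he hys (mem_triSet hb) (by rintro rfl; linarith) hz hz0
  have hzf := sqn_lt_of_openSegment' hbf hyf (openSegment_symm ℝ y b ▸ hz)
  have hfu := hf' u he.left_mem_above
  have hfv := hf' v he.right_mem_above
  refine orderKTri_of_affFn (Finset.card_pos.1 (by omega)) hf ((encard_le_encard ?_).trans hgk)
  rintro p ⟨hp, hpf⟩
  refine ⟨hp, ?_⟩
  obtain ⟨z', hz', hz0'⟩ := exists_cross hy0 (hbelow p hp hpf)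
  have hzf' := sqn_lt_of_openSegment' hpf hyf (openSegment_symm ℝ y p ▸ hz')
  have hzuv' := chord_lt he.ne hfu hfv hzuv hzf.le hz0' hzf'
  have h1 : f z' ≤ g z' := by
    obtain ⟨a, b, ha, hb, hab, rfl⟩ := hzuv'
    rw [f.map_comb hab, g.map_comb hab, hgu, hgv]
    exact add_le_add (mul_le_mul_of_nonneg_left hfu ha.le) (mul_le_mul_of_nonneg_left hfv hb.le)
  have h2 : g y ≤ f y := AffFn.le_of_mem_triSet (fun i hi => by
    rw [hf i hi]
    exact hgP i (htA hi).1 (htA hi).2) (openHull_subset_triSet _ hyt)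
  obtain ⟨a, b, ha, hb, hab, rfl⟩ := hz'
  rw [f.map_comb hab, g.map_comb hab] at h1
  have := mul_le_mul_of_nonneg_left h2 ha.le
  have : f p ≤ g p := le_of_mul_le_mul_left (by linarith) hb
  linarith

lemma IsDel.isOpen_openHull (hP : GenPos P) (hs : IsDel P s) : IsOpen (openHull s) := by
  rw [← (hs.tri hP).interior_eq]
  exact isOpen_interior

lemma IsDel.triSet_subset_closure (hP : GenPos P) (hs : IsDel P s) :
    triSet s ⊆ closure (openHull s) := by
  rw [← (hs.tri hP).interior_eq]
  exact (hs.tri hP).triSet_subset_closure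

lemma convex_openHull (A : Finset Pt) : Convex ℝ (openHull A) := by
  rintro x ⟨w, hw0, hw1, rfl⟩ y ⟨w', hw0', hw1', rfl⟩ a b ha hb hab
  refine ⟨fun i => a * w i + b * w' i, fun i hi => ?_, ?_, ?_⟩
  · rcases ha.eq_or_lt with h | h
    · have : 0 < b := by linarith
      have := mul_pos this (hw0' i hi)
      have := mul_nonneg ha (hw0 i hi).le
      dsimp only
      linarith
    · have := mul_pos h (hw0 i hi)
      have := mul_nonneg hb (hw0' i hi).le
      dsimp only
      linarith
  · rw [Finset.sum_add_distrib, ← Finset.mul_sum, ← Finset.mul_sum, hw1, hw1']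
    linarith
  · simp_rw [add_smul, Finset.sum_add_distrib, mul_smul, ← Finset.smul_sum]

lemma UpperRetri.hull_of_meet (hfin : P.Finite) (hP : GenPos P) (he : NonDel P u v)
    (ht : UpperRetri P u v t) (hs : IsDel P s) (hmeet : (openHull t ∩ triSet s).Nonempty) :
    Hull P u v s := by
  by_contra hns
  have hA := hP.mono (above_subset (P := P) (u := u) (v := v))
  have htP : (t : Set Pt) ⊆ P := ht.1.2.1.trans above_subset
  have hpre : IsPreconnected (openHull t) := (convex_openHull t).isPreconnected
  have hc1 : IsClosed (⋃ r ∈ {r | Hull P u v r}, triSet r) :=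
    isClosed_biUnion_triSet ((finite_isDel hfin).subset fun r hr => hr.1)
  have hc2 : IsClosed (⋃ r ∈ {r | IsDel P r ∧ ¬ Hull P u v r}, triSet r) :=
    isClosed_biUnion_triSet ((finite_isDel hfin).subset fun r hr => hr.1)
  obtain ⟨z, hzt, hz1, hz2⟩ := isPreconnected_closed_iff.1 hpre _ _ hc1 hc2 (by
      intro y hy
      have hyP : y ∈ convexHull ℝ P := convexHull_mono htP (openHull_subset_triSet _ hy)
      obtain ⟨r, hr, hyr⟩ := exists_isDel_mem hfin hP ht.1.1 htP hyP
      by_cases hrH : Hull P u v r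
      · exact Or.inl (mem_biUnion (x := r) hrH hyr)
      · exact Or.inr (mem_biUnion (x := r) ⟨hr, hrH⟩ hyr))
    (by
      obtain ⟨r, hr, y, hyt, hyr⟩ := ht.2
      exact ⟨y, hyt, mem_biUnion (x := r) hr hyr⟩)
    (by
      obtain ⟨y, hyt, hys⟩ := hmeet
      exact ⟨y, hyt, mem_biUnion (x := s) ⟨hs, hns⟩ hys⟩)
  simp only [mem_iUnion] at hz1 hz2
  obtain ⟨s₁, hs₁, hz1⟩ := hz1
  obtain ⟨s₂, ⟨hs₂, hns₂⟩, hz2⟩ := hz2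
  obtain ⟨B, hB₁, hzB⟩ := exists_support hz1
  have hB₂ := hs₂.face_subset hP hs₁.1 hB₁ hz2 hzB
  by_cases hBA : (B : Set Pt) ⊆ above P u v
  · obtain ⟨h3, hsP, f₁, hf₁, hf₁'⟩ := id hs₁.1
    have hBt := ht.1.subset_of_meet hA hBA (fun i hi => hf₁ i (hB₁ hi))
      (fun i hi => hf₁' i (htP hi)) (openHull_subset_triSet _ hzt) hzB
    obtain ⟨ht3, htA, f, hf, hf'⟩ := id ht.1
    have h1 : f z ≤ f₁ z := AffFn.le_of_mem_triSet (fun i hi => by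
      rw [hf i (hBt hi), hf₁ i (hB₁ hi)]) (openHull_subset_triSet _ hzB)
    have h2 := AffFn.eq_of_mem_openHull (f := f₁) (g := f) (fun i hi => by
      rw [hf i hi]; exact hf₁' i (htP hi)) hzt h1
    refine ht.ne_of_isDel hP he hs₁ (Finset.eq_of_subset_of_card_le (fun i hi => ?_) ?_)
    · exact hP.mem_of_eq h3 hsP hf₁ (htP hi) ((h2 i hi).trans (hf i hi))
    · rw [h3, ht3]
  · obtain ⟨b, hb, hbA⟩ := not_subset.1 hBA
    have hb0 : hgt u v b < 0 := by
      by_contra! h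
      exact hbA ⟨hs₁.1.2.1 (hB₁ hb), h⟩
    have hz0 := ht.hgt_pos hP he hzt
    obtain ⟨a, ha, ha0⟩ : ∃ a ∈ B, 0 < hgt u v a := by
      by_contra! hcon
      have := AffFn.le_of_mem_triSet (f := hgt u v) (g := 0) hcon (openHull_subset_triSet _ hzB)
      exact absurd hz0 (not_lt.2 this)
    obtain ⟨x, hx, hx0⟩ := exists_cross ha0 hb0
    refine hns₂ ⟨hs₂, x, hs₁.cross_mem he (mem_triSet (hB₁ ha)) (mem_triSet (hB₁ hb))
      (by rintro rfl; linarith) hx hx0, ?_⟩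
    exact segment_subset_triSet (mem_triSet (hB₂ ha)) (mem_triSet (hB₂ hb))
      (openSegment_subset_segment _ _ _ hx)

end

section

variable {P : Set Pt} {u v : Pt} {s t : Finset Pt}

lemma Hull.mem_convexHull_above (he : NonDel P u v) (hs : Hull P u v s) {x : Pt}
    (hx : x ∈ triSet s) (hx0 : 0 < hgt u v x) : x ∈ convexHull ℝ (above P u v) := by
  have hsP : (s : Set Pt) ⊆ P := hs.1.2.1
  have huA : u ∈ convexHull ℝ (above P u v) := subset_convexHull ℝ _ he.left_mem_above
  have hvA : v ∈ convexHull ℝ (above P u v) := subset_convexHull ℝ _ he.right_mem_above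
  set S₁ : Set Pt := {p | p ∈ s ∧ 0 ≤ hgt u v p} with hS₁
  set S₂ : Set Pt := {p | p ∈ s ∧ hgt u v p < 0} with hS₂
  have hun : (s : Set Pt) = S₁ ∪ S₂ := by
    ext p
    simp only [hS₁, hS₂, mem_union, mem_ofPred_eq, Finset.mem_coe, ← and_or_left]
    exact ⟨fun h => ⟨h, le_or_gt _ _⟩, fun h => h.1⟩
  have hS₁A : convexHull ℝ S₁ ⊆ convexHull ℝ (above P u v) :=
    convexHull_mono fun p hp => ⟨hsP hp.1, hp.2⟩
  have hS₂n : ∀ b ∈ convexHull ℝ S₂, hgt u v b < 0 := by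
    have hconv : Convex ℝ {b | hgt u v b < 0} := by
      intro p hp q hq a b ha hb hab
      simp only [mem_ofPred_eq] at *
      rw [(hgt u v).map_comb hab]
      rcases ha.eq_or_lt with h | h
      · have hb1 : b = 1 := by linarith
        rw [← h, hb1]
        linarith
      · have := mul_neg_of_pos_of_neg h hp
        have := mul_nonpos_of_nonneg_of_nonpos hb hq.le
        linarith
    exact fun b hb => convexHull_min (fun p hp => hp.2) hconv hb
  unfold triSet at hx
  rw [hun] at hx
  by_cases h1 : S₁.Nonempty
  swap
  · rw [not_nonempty_iff_eq_empty.1 h1, empty_union] at hx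
    exact absurd hx0 (not_lt.2 (hS₂n x hx).le)
  by_cases h2 : S₂.Nonempty
  swap
  · rw [not_nonempty_iff_eq_empty.1 h2, union_empty] at hx
    exact hS₁A hx
  rw [convexHull_union h1 h2, mem_convexJoin] at hx
  obtain ⟨A, hA, B, hB, α, β, hα, hβ, hαβ, rfl⟩ := hx
  have hB0 := hS₂n B hB
  rw [(hgt u v).map_comb hαβ] at hx0
  have hA0 : 0 < hgt u v A := by
    by_contra! h
    have := mul_nonpos_of_nonneg_of_nonpos hα h
    have := mul_nonpos_of_nonneg_of_nonpos hβ hB0.le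
    linarith
  obtain ⟨z, hz, hz0⟩ := exists_cross hA0 hB0
  have hAs : A ∈ triSet s := convexHull_mono (hun ▸ subset_union_left) hA
  have hBs : B ∈ triSet s := convexHull_mono (hun ▸ subset_union_right) hB
  have hzuv := hs.cross_mem he hAs hBs (by rintro rfl; linarith) hz hz0
  have hzA : z ∈ convexHull ℝ (above P u v) := (convex_convexHull ℝ _).segment_subset huA hvA
    (openSegment_subset_segment _ _ _ hzuv)
  obtain ⟨a, c, ha, hc, hac, rfl⟩ := hz
  rw [(hgt u v).map_comb hac] at hz0
  have hβc : β ≤ c := by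
    obtain rfl : α = 1 - β := by linarith
    obtain rfl : a = 1 - c := by linarith
    by_contra! h
    nlinarith
  have := (convex_convexHull ℝ (above P u v)) (hS₁A hA) hzA
    (sub_nonneg.2 ((div_le_one hc).2 hβc)) (div_nonneg hβ hc.le) (by ring)
  have e : α • A + β • B = (1 - β / c) • A + (β / c) • (a • A + c • B) := by
    obtain rfl : α = 1 - β := by linarith
    obtain rfl : a = 1 - c := by linarith
    match_scalars <;> field_simp
    ring
  rw [e]
  exact this

lemma Hull.exists_upperRetri (hfin : P.Finite) (hP : GenPos P) (he : NonDel P u v)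
    (hs : Hull P u v s) {x : Pt} (hx : x ∈ openHull s) (hx0 : 0 < hgt u v x) :
    ∃ t, UpperRetri P u v t ∧ x ∈ triSet t := by
  have hA := hP.mono (above_subset (P := P) (u := u) (v := v))
  obtain ⟨a, ha, ha0⟩ := hs.exists_pos hP he
  have hau : a ≠ u := by rintro rfl; rw [hgt_left] at ha0; exact lt_irrefl _ ha0
  have hav : a ≠ v := by rintro rfl; rw [hgt_right] at ha0; exact lt_irrefl _ ha0
  have h3 : ({u, v, a} : Finset Pt).card = 3 :=
    Finset.card_eq_three.2 ⟨u, v, a, he.ne, hau.symm, hav.symm, rfl⟩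
  have hsub : (({u, v, a} : Finset Pt) : Set Pt) ⊆ above P u v := by
    simp only [Finset.coe_insert, Finset.coe_singleton, insert_subset_iff, singleton_subset_iff]
    exact ⟨he.left_mem_above, he.right_mem_above, hs.1.2.1 ha, ha0.le⟩
  obtain ⟨t, ht, hxt⟩ := exists_isDel_mem (hfin.subset above_subset) hA h3 hsub
    (hs.mem_convexHull_above he (openHull_subset_triSet _ hx) hx0)
  obtain ⟨y, hys, hyt⟩ := mem_closure_iff.1 (ht.triSet_subset_closure hA hxt) _
    (hs.1.isOpen_openHull hP) hx
  exact ⟨t, ⟨ht, s, hs, y, hyt, openHull_subset_triSet _ hys⟩, hxt⟩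

lemma Retri.card_subset (ht : Retri P u v t) : t.card = 3 ∧ (t : Set Pt) ⊆ P := by
  rcases ht with ht | ht
  · exact ⟨ht.1.1, ht.1.2.1.trans above_subset⟩
  · exact ⟨ht.1.1, ht.1.2.1.trans above_subset⟩

lemma finite_retri (hfin : P.Finite) : {t | Retri P u v t}.Finite :=
  (finite_finsets hfin).subset fun _ ht => ht.card_subset.2

lemma Hull.subset_retri (hfin : P.Finite) (hP : GenPos P) (he : NonDel P u v)
    (hs : Hull P u v s) : triSet s ⊆ ⋃ t ∈ {t | Retri P u v t}, triSet t := by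
  have hcl := isClosed_biUnion_triSet (finite_retri (u := u) (v := v) hfin)
  refine (hs.1.triSet_subset_closure hP).trans (closure_minimal ?_ hcl)
  refine subset_of_closed_of_generic hfin (hs.1.isOpen_openHull hP) hcl fun x hx hg => ?_
  rcases lt_or_gt_of_ne (hg u he.left v he.right he.ne) with h | h
  · obtain ⟨t, ht, hxt⟩ := hs.symm.exists_upperRetri hfin hP he.symm hx
      (by rw [hgt_swap]; linarith)
    exact mem_biUnion (x := t) (Or.inr ht) hxt
  · obtain ⟨t, ht, hxt⟩ := hs.exists_upperRetri hfin hP he hx h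
    exact mem_biUnion (x := t) (Or.inl ht) hxt

lemma Retri.hull_of_meet (hfin : P.Finite) (hP : GenPos P) (he : NonDel P u v)
    (ht : Retri P u v t) (hs : IsDel P s) (hmeet : (openHull t ∩ triSet s).Nonempty) :
    Hull P u v s := by
  rcases ht with ht | ht
  · exact ht.hull_of_meet hfin hP he hs hmeet
  · exact (ht.hull_of_meet hfin hP he.symm hs hmeet).symm

lemma Retri.eq_of_meet (hP : GenPos P) (he : NonDel P u v) (hs : Retri P u v s)
    (ht : Retri P u v t) {z : Pt} (hzs : z ∈ openHull s) (hzt : z ∈ openHull t) : s = t := by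
  rcases hs with hs | hs <;> rcases ht with ht | ht
  · exact hs.1.eq_of_meet (hP.mono above_subset) ht.1 (openHull_subset_triSet _ hzs) hzt
  · have h1 := hs.hgt_pos hP he hzs
    have h2 := ht.hgt_pos hP he.symm hzt
    rw [hgt_swap] at h2
    linarith
  · have h1 := hs.hgt_pos hP he.symm hzs
    have h2 := ht.hgt_pos hP he hzt
    rw [hgt_swap] at h1
    linarith
  · exact hs.1.eq_of_meet (hP.mono above_subset) ht.1 (openHull_subset_triSet _ hzs) hzt

lemma UpperRetri.mem_of_mem_triSet (hP : GenPos P) (ht : UpperRetri P u v t) {p : Pt}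
    (hp : p ∈ P) (hpt : p ∈ triSet t) : p ∈ t :=
  ht.1.mem_of_mem_triSet (hP.mono above_subset)
    ⟨hp, AffFn.nonneg_of_mem_triSet (fun _ hi => (ht.1.2.1 hi).2) hpt⟩ hpt

lemma Retri.mem_of_mem_triSet (hP : GenPos P) (ht : Retri P u v t) {p : Pt}
    (hp : p ∈ P) (hpt : p ∈ triSet t) : p ∈ t :=
  ht.elim (fun h => h.mem_of_mem_triSet hP hp hpt) (fun h => h.mem_of_mem_triSet hP hp hpt)

lemma exists_upperRetri_edge (hfin : P.Finite) (hP : GenPos P) (he : NonDel P u v) {k : ℕ}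
    {g : AffFn} (hg : Cap P k u v g) : ∃ t, Retri P u v t ∧ u ∈ t ∧ v ∈ t := by
  obtain ⟨hgu, hgv, hgP, -, w, hw, hw0, hgw⟩ := hg
  have hwu : w ≠ u := by rintro rfl; rw [hgt_left] at hw0; exact lt_irrefl _ hw0
  have hwv : w ≠ v := by rintro rfl; rw [hgt_right] at hw0; exact lt_irrefl _ hw0
  have h3 : ({u, v, w} : Finset Pt).card = 3 :=
    Finset.card_eq_three.2 ⟨u, v, w, he.ne, hwu.symm, hwv.symm, rfl⟩
  have hsub : (({u, v, w} : Finset Pt) : Set Pt) ⊆ above P u v := by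
    simp only [Finset.coe_insert, Finset.coe_singleton, insert_subset_iff, singleton_subset_iff]
    exact ⟨he.left_mem_above, he.right_mem_above, hw, hw0.le⟩
  refine ⟨{u, v, w}, Or.inl ⟨⟨h3, hsub, g, ?_, fun q hq => hgP q hq.1 hq.2⟩, ?_⟩, by simp, by simp⟩
  · intro i hi
    simp only [Finset.mem_insert, Finset.mem_singleton] at hi
    rcases hi with rfl | rfl | rfl <;> assumption
  · exact exists_hull_meet hfin hP he.ne h3 (hsub.trans above_subset) (by simp) (by simp)

lemma IsDel.orderKTri (hs : IsDel P s) (k : ℕ) : OrderKTri P k s := by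
  obtain ⟨h3, hsP, f, hf, hf'⟩ := id hs
  refine orderKTri_of_affFn hs.nonempty hf ?_
  have : {p ∈ P | sqn p < f p} = ∅ := by
    rw [eq_empty_iff_forall_notMem]
    rintro p ⟨hp, hlt⟩
    exact absurd hlt (not_lt.2 (hf' p hp))
  rw [this]
  simp

lemma isOrderDT_isDel (hfin : P.Finite) (hP : GenPos P) (ht : t.card = 3)
    (htP : (t : Set Pt) ⊆ P) : IsOrderDT P 0 {s | IsDel P s} := by
  refine ⟨⟨finite_isDel hfin, fun s hs => ⟨hs.1, hs.2.1⟩, fun p hp => ?_, fun s hs r hr hne => ?_,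
    ?_⟩, fun s hs => hs.orderKTri 0⟩
  · obtain ⟨s, hs, hps⟩ := exists_isDel_mem hfin hP ht htP (subset_convexHull ℝ P hp)
    exact ⟨s, hs, hs.mem_of_mem_triSet hP hp hps⟩
  · beta_reduce
    rw [(hs.tri hP).interior_eq, (hr.tri hP).interior_eq, eq_empty_iff_forall_notMem]
    rintro z ⟨hz, hz'⟩
    exact hne (hs.eq_of_meet hP hr (openHull_subset_triSet _ hz) hz')
  · refine Subset.antisymm (iUnion₂_subset fun s hs => convexHull_mono hs.2.1) fun x hx => ?_
    obtain ⟨s, hs, hxs⟩ := exists_isDel_mem hfin hP ht htP hx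
    exact mem_biUnion (x := s) hs hxs

end

section

variable {P : Set Pt} {ι : Type*} {u v : ι → Pt}

/-- The Delaunay triangulation with the hulls of the pairs indexed by `S` retriangulated. -/
def glue (P : Set Pt) (u v : ι → Pt) (S : Set ι) : Set (Finset Pt) :=
  {t | (IsDel P t ∧ ∀ i ∈ S, ¬ Hull P (u i) (v i) t) ∨ ∃ i ∈ S, Retri P (u i) (v i) t}

lemma glue_card_subset {S : Set ι} {t : Finset Pt} (ht : t ∈ glue P u v S) :
    t.card = 3 ∧ (t : Set Pt) ⊆ P := by
  rcases ht with ⟨ht, -⟩ | ⟨i, -, ht⟩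
  · exact ⟨ht.1, ht.2.1⟩
  · exact ht.card_subset

lemma glue_isTriangulation (hfin : P.Finite) (hP : GenPos P) {t₀ : Finset Pt} (ht₀ : t₀.card = 3)
    (ht₀P : (t₀ : Set Pt) ⊆ P) (he : ∀ i, NonDel P (u i) (v i))
    (hdisj : ∀ i j s, Hull P (u i) (v i) s → Hull P (u j) (v j) s → i = j) (S : Set ι) :
    IsTriangulation P (glue P u v S) := by
  have hcov : ∀ x ∈ convexHull ℝ P, ∃ t ∈ glue P u v S, x ∈ triSet t := by
    intro x hx
    obtain ⟨s, hs, hxs⟩ := exists_isDel_mem hfin hP ht₀ ht₀P hx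
    by_cases h : ∃ i ∈ S, Hull P (u i) (v i) s
    · obtain ⟨i, hi, hsi⟩ := h
      have := hsi.subset_retri hfin hP (he i) hxs
      simp only [mem_iUnion] at this
      obtain ⟨t, ht, hxt⟩ := this
      exact ⟨t, Or.inr ⟨i, hi, ht⟩, hxt⟩
    · push Not at h
      exact ⟨s, Or.inl ⟨hs, h⟩, hxs⟩
  have hDR : ∀ s t, (IsDel P s ∧ ∀ i ∈ S, ¬ Hull P (u i) (v i) s) →
      (∃ i ∈ S, Retri P (u i) (v i) t) → ∀ z ∈ openHull s, z ∉ openHull t := by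
    rintro s t ⟨hs, hsS⟩ ⟨i, hi, ht⟩ z hzs hzt
    exact hsS i hi (ht.hull_of_meet hfin hP (he i) hs ⟨z, hzt, openHull_subset_triSet _ hzs⟩)
  refine ⟨(finite_finsets hfin).subset fun t ht => (glue_card_subset ht).2,
    fun t ht => glue_card_subset ht, fun p hp => ?_, fun s hs t ht hne => ?_, ?_⟩
  · obtain ⟨t, ht, hpt⟩ := hcov p (subset_convexHull ℝ P hp)
    refine ⟨t, ht, ?_⟩
    rcases ht with ⟨ht, -⟩ | ⟨i, -, ht⟩
    · exact ht.mem_of_mem_triSet hP hp hpt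
    · exact ht.mem_of_mem_triSet hP hp hpt
  · have h1 := glue_card_subset hs
    have h2 := glue_card_subset ht
    beta_reduce
    rw [(hP.tri h1.1 h1.2).interior_eq, (hP.tri h2.1 h2.2).interior_eq,
      eq_empty_iff_forall_notMem]
    rintro z ⟨hz, hz'⟩
    rcases hs with hs | hs <;> rcases ht with ht | ht
    · exact hne (hs.1.eq_of_meet hP ht.1 (openHull_subset_triSet _ hz) hz')
    · exact hDR s t hs ht z hz hz'
    · exact hDR t s ht hs z hz' hz
    · obtain ⟨i, -, hs⟩ := hs
      obtain ⟨j, -, ht⟩ := ht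
      obtain ⟨r, hr, hzr⟩ := exists_isDel_mem hfin hP ht₀ ht₀P
        (convexHull_mono h1.2 (openHull_subset_triSet _ hz))
      have hri := hs.hull_of_meet hfin hP (he i) hr ⟨z, hz, hzr⟩
      have hrj := ht.hull_of_meet hfin hP (he j) hr ⟨z, hz', hzr⟩
      obtain rfl := hdisj i j r hri hrj
      exact hne (hs.eq_of_meet hP (he i) ht hz hz')
  · refine Subset.antisymm (iUnion₂_subset fun s hs => convexHull_mono (glue_card_subset hs).2)
      fun x hx => ?_
    obtain ⟨t, ht, hxt⟩ := hcov x hx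
    exact mem_biUnion (x := t) ht hxt

lemma glue_orderKTri (hP : GenPos P) {k : ℕ} (he : ∀ i, NonDel P (u i) (v i))
    (hcap : ∀ i, ∃ g, Cap P k (u i) (v i) g) (hcap' : ∀ i, ∃ g, Cap P k (v i) (u i) g)
    {S : Set ι} {t : Finset Pt} (ht : t ∈ glue P u v S) : OrderKTri P k t := by
  rcases ht with ⟨ht, -⟩ | ⟨i, -, ht | ht⟩
  · exact ht.orderKTri k
  · obtain ⟨g, hg⟩ := hcap i
    exact ht.orderKTri hP (he i) hg
  · obtain ⟨g, hg⟩ := hcap' i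
    exact ht.orderKTri hP (he i).symm hg

lemma mem_iff_exists_mem_glue (hfin : P.Finite) (hP : GenPos P) {k : ℕ}
    (he : ∀ i, NonDel P (u i) (v i)) (hcap : ∀ i, ∃ g, Cap P k (u i) (v i) g)
    (hdisj : ∀ i j s, Hull P (u i) (v i) s → Hull P (u j) (v j) s → i = j) {S : Set ι} {i : ι} :
    i ∈ S ↔ ∃ t ∈ glue P u v S, u i ∈ t ∧ v i ∈ t := by
  constructor
  · intro hi
    obtain ⟨g, hg⟩ := hcap i
    obtain ⟨t, ht, hut, hvt⟩ := exists_upperRetri_edge hfin hP (he i) hg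
    exact ⟨t, Or.inr ⟨i, hi, ht⟩, hut, hvt⟩
  · rintro ⟨t, ⟨ht, -⟩ | ⟨j, hj, ht⟩, hut, hvt⟩
    · exact absurd hvt ((he i).notMem t ht hut)
    · obtain ⟨s, hs, hmeet⟩ := exists_hull_meet hfin hP (he i).ne ht.card_subset.1
        ht.card_subset.2 hut hvt
      rw [hdisj i j s hs (ht.hull_of_meet hfin hP (he j) hs.1 hmeet)]
      exact hj

end

/-- `u v` is not a Delaunay edge, and `g`, `g'` are its order-`k` caps on the two sides. -/
structure Lens (P : Set Pt) (k : ℕ) (u v : Pt) (g g' : AffFn) : Prop where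
  nonDel : NonDel P u v
  cap : Cap P k u v g
  cap' : Cap P k v u g'

/-- The points of `P` inside one of two disks. -/
def lens (P : Set Pt) (g g' : AffFn) : Set Pt := {p ∈ P | sqn p < g p ∨ sqn p < g' p}

section

variable {P : Set Pt} {k : ℕ} {u v a b : Pt} {g g' : AffFn} {s : Finset Pt}

lemma Lens.symm (h : Lens P k u v g g') : Lens P k v u g' g := ⟨h.nonDel.symm, h.cap', h.cap⟩

lemma lens_comm : lens P g g' = lens P g' g := by
  ext p
  simp only [lens, mem_ofPred_eq, or_comm]

lemma finite_lens (hfin : P.Finite) : (lens P g g').Finite := hfin.subset fun _ hp => hp.1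

lemma Lens.ncard_le (hfin : P.Finite) (h : Lens P k u v g g') : (lens P g g').ncard ≤ 2 * k := by
  have hsub : lens P g g' ⊆ {p ∈ P | sqn p < g p} ∪ {p ∈ P | sqn p < g' p} := fun p hp =>
    hp.2.imp (fun h => ⟨hp.1, h⟩) (fun h => ⟨hp.1, h⟩)
  have h1 : (lens P g g').encard ≤ (2 * k : ℕ) := by
    refine ((encard_le_encard hsub).trans (encard_union_le _ _)).trans ?_
    rw [two_mul, Nat.cast_add]
    exact add_le_add h.cap.2.2.2.1 h.cap'.2.2.2.1
  rw [← (finite_lens hfin).cast_ncard_eq] at h1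
  exact_mod_cast h1

lemma Lens.lt_of_cross (hP : GenPos P) (h : Lens P k u v g g') (hs : IsDel P s) (ha : a ∈ s)
    (hb : b ∈ s) (hb0 : hgt u v b < 0) {z : Pt} (hz : z ∈ openSegment ℝ u v)
    (hzab : z ∈ openSegment ℝ a b) : sqn a < g' a := by
  obtain ⟨hgv, hgu, hg, -⟩ := h.cap'
  have hd := h.nonDel
  have hgb : g' b ≤ sqn b := hg b (hs.2.1 hb) (by rw [hgt_swap]; linarith)
  obtain ⟨h3, hsP, f, hf, hf'⟩ := id hs
  have hfz : f z < g' z := by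
    obtain ⟨x, y, hx, hy, hxy, rfl⟩ := hz
    rw [f.map_comb hxy, g'.map_comb hxy, hgu, hgv]
    have h1 := mul_le_mul_of_nonneg_left (hf' u hd.left) hx.le
    have h2 := mul_le_mul_of_nonneg_left (hf' v hd.right) hy.le
    by_contra! hle
    have hu : f u = sqn u := (hf' u hd.left).antisymm (le_of_mul_le_mul_left (by linarith) hx)
    have hv : f v = sqn v := (hf' v hd.right).antisymm (le_of_mul_le_mul_left (by linarith) hy)
    exact hd.notMem s hs (hP.mem_of_eq h3 hsP hf hd.left hu) (hP.mem_of_eq h3 hsP hf hd.right hv)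
  obtain ⟨x, y, hx, hy, hxy, rfl⟩ := hzab
  rw [f.map_comb hxy, g'.map_comb hxy, hf a ha, hf b hb] at hfz
  have := mul_le_mul_of_nonneg_left hgb hy.le
  exact lt_of_mul_lt_mul_left (by linarith) hx.le

lemma Lens.mem_of_cross (hP : GenPos P) (h : Lens P k u v g g') (hs : IsDel P s) (ha : a ∈ s)
    (hb : b ∈ s) (hab : hgt u v a * hgt u v b < 0) {z : Pt} (hz : z ∈ openSegment ℝ u v)
    (hzab : z ∈ openSegment ℝ a b) : a ∈ lens P g g' := by
  rcases mul_neg_iff.1 hab with ⟨-, h0⟩ | ⟨-, h0⟩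
  · exact ⟨hs.2.1 ha, Or.inr (h.lt_of_cross hP hs ha hb h0 hz hzab)⟩
  · exact ⟨hs.2.1 ha, Or.inl (h.symm.lt_of_cross hP hs ha hb (by rw [hgt_swap]; linarith)
      (openSegment_symm ℝ u v ▸ hz) hzab)⟩

lemma sqn_lt_of_cross {L G h : AffFn} {q z : Pt} {x y w : ℝ} (hLa : L a = sqn a)
    (hLb : L b = sqn b) (hLu : L u = sqn u) (hGu : G u = sqn u) (hLv : L v ≤ G v)
    (hGa : sqn a < G a) (hGb : G b ≤ sqn b) (hu : h u = 0) (hv : h v = 0) (ha : 0 < h a)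
    (hz : z ∈ openSegment ℝ u v) (hzab : z ∈ openSegment ℝ a b) (hxyw : x + y + w = 1)
    (hx : 0 < x) (hq : q = x • u + y • a + w • b) (hqL : sqn q < L q) (hq0 : 0 ≤ h q) :
    sqn q < G q := by
  by_contra! hcon
  have hLq := L.map_comb₃ hxyw u a b
  have hGq := G.map_comb₃ hxyw u a b
  have hhq := h.map_comb₃ hxyw u a b
  rw [← hq] at hLq hGq hhq
  have hpos : 0 < y * (L a - G a) + w * (L b - G b) := by
    rw [hLu] at hLq
    rw [hGu] at hGq
    linarith
  rcases le_or_gt w 0 with hw | hw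
  · have hy : y < 0 := by
      by_contra! hy
      have := mul_nonneg hy (sub_pos.2 hGa).le
      have := mul_nonneg (neg_nonneg.2 hw) (sub_nonneg.2 hGb)
      rw [hLa, hLb] at hpos
      linarith
    have hyw : 0 < -y - w := by linarith
    have h1 : -y / (-y - w) + -w / (-y - w) = 1 := by field_simp; ring
    have hm : sqn ((-y / (-y - w)) • a + (-w / (-y - w)) • b) ≤
        L ((-y / (-y - w)) • a + (-w / (-y - w)) • b) :=
      (convex_disk L) hLa.ge hLb.ge (div_nonneg (by linarith) hyw.le)
        (div_nonneg (by linarith) hyw.le) h1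
    have hx1 : 1 < x := by linarith
    have := sqn_lt_of_openSegment' (z := u) hqL hm
      ⟨1 / x, 1 - 1 / x, by positivity, sub_pos.2 ((div_lt_one hx).2 hx1), by ring, by
        obtain rfl : x = 1 - y - w := by linarith
        rw [hq]
        have h2 : 1 - y - w ≠ 0 := hx.ne'
        have h3 : -y - w ≠ 0 := hyw.ne'
        match_scalars <;> field_simp <;> ring⟩
    linarith
  · obtain ⟨l, m, hl, hm, hlm, hz'⟩ := hzab
    have hLz := L.map_comb hlm a b
    have hGz := G.map_comb hlm a b
    have hhz := h.map_comb hlm a b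
    rw [hz', AffFn.eq_zero_of_openSegment hu hv hz] at hhz
    rw [hz'] at hLz hGz
    have hzle : L z ≤ G z := by
      obtain ⟨c, d, hc, hd, hcd, rfl⟩ := hz
      rw [L.map_comb hcd, G.map_comb hcd, hLu, hGu]
      have := mul_le_mul_of_nonneg_left hLv hd.le
      linarith
    have h1 : 0 ≤ y * m - w * l := by
      have : 0 ≤ (y * m - w * l) * h a := by
        have h2 : m * h q = (y * m - w * l) * h a := by
          rw [hhq, hu]
          linear_combination w * (-hhz)
        rw [← h2]
        exact mul_nonneg hm.le hq0
      exact nonneg_of_mul_nonneg_left this ha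
    have h2 : (y * m - w * l) * (L a - G a) ≤ 0 :=
      mul_nonpos_of_nonneg_of_nonpos h1 (by linarith)
    have h3 : w * (L z - G z) ≤ 0 := mul_nonpos_of_nonneg_of_nonpos hw.le (by linarith)
    rw [hLz, hGz] at h3
    have h4 := mul_pos hm hpos
    linarith

end

section

variable {P : Set Pt} {k : ℕ} {u v a b c d : Pt} {g g' : AffFn} {s t : Finset Pt}

lemma exists_comb (h : hgt a b c ≠ 0) (p : Pt) :
    ∃ x y w : ℝ, x + y + w = 1 ∧ p = x • a + y • b + w • c := by
  refine ⟨hgt b c p / hgt a b c, hgt c a p / hgt a b c, hgt a b p / hgt a b c, ?_, ?_⟩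
  · field_simp
    rw [hgt_apply, hgt_apply, hgt_apply, hgt_apply]
    ring
  · ext i
    have : p i * hgt a b c = hgt b c p * a i + hgt c a p * b i + hgt a b p * c i := by
      rw [hgt_apply, hgt_apply, hgt_apply, hgt_apply]
      fin_cases i <;> simp <;> ring
    simp only [PiLp.add_apply, PiLp.smul_apply, smul_eq_mul]
    field_simp
    linarith

lemma mem_openHull_three (hab : a ≠ b) (hca : c ≠ a) (hcb : c ≠ b) {x y w : ℝ} (hx : 0 < x)
    (hy : 0 < y) (hw : 0 < w) (h : x + y + w = 1) :
    x • a + y • b + w • c ∈ openHull {a, b, c} := by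
  refine ⟨fun i => if i = a then x else if i = b then y else w, fun i _ => ?_, ?_, ?_⟩
  · dsimp only
    split_ifs <;> assumption
  · rw [sum_three hab hca hcb]
    simpa [hab.symm, hca, hcb] using h
  · rw [sum_three hab hca hcb]
    simp [hab.symm, hca, hcb]

lemma mem_triSet_three {x y w : ℝ} (ha : a ∈ s) (hb : b ∈ s) (hc : c ∈ s) (hx : 0 ≤ x)
    (hy : 0 ≤ y) (hw : 0 ≤ w) (h : x + y + w = 1) :
    x • a + y • b + w • c ∈ triSet s := by
  have := (convex_convexHull ℝ (s : Set Pt)).sum_mem (t := Finset.univ) (w := ![x, y, w])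
    (z := ![a, b, c]) (by intro i _; fin_cases i <;> simpa) (by simpa [Fin.sum_univ_three] using h)
    (by intro i _; fin_cases i <;> [exact mem_triSet ha; exact mem_triSet hb; exact mem_triSet hc])
  rwa [Fin.sum_univ_three] at this

lemma Finset.eq_three (ht : t.card = 3) (ha : a ∈ t) (hb : b ∈ t) (hc : c ∈ t) (hab : a ≠ b)
    (hca : c ≠ a) (hcb : c ≠ b) : t = {a, b, c} := by
  refine (Finset.eq_of_subset_of_card_le ?_ ?_).symm
  · simp [Finset.insert_subset_iff, ha, hb, hc]
  · rw [ht, Finset.card_eq_three.2 ⟨a, b, c, hab, hca.symm, hcb.symm, rfl⟩]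

lemma ne_of_hgt_neg (ha : 0 < hgt u v a) (hb : hgt u v b < 0) : a ≠ b := by
  rintro rfl
  linarith

lemma ne_left_of_hgt (ha : hgt u v a ≠ 0) : a ≠ u := by
  rintro rfl
  exact ha (hgt_left a v)

lemma ne_right_of_hgt (ha : hgt u v a ≠ 0) : a ≠ v := by
  rintro rfl
  exact ha (hgt_right u a)

lemma Hull.exists_cross (he : NonDel P u v) (hs : Hull P u v s) (ha : a ∈ s)
    (hb : b ∈ s) (ha0 : 0 < hgt u v a) (hb0 : hgt u v b < 0) :
    ∃ z ∈ openSegment ℝ u v, z ∈ openSegment ℝ a b := by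
  obtain ⟨z, hz, hz0⟩ := _root_.exists_cross ha0 hb0
  exact ⟨z, hs.cross_mem he (mem_triSet ha) (mem_triSet hb) (ne_of_hgt_neg ha0 hb0) hz hz0, hz⟩

lemma Hull.mem_openHull_of_left (hP : GenPos P) (he : NonDel P u v) (hs : Hull P u v s)
    (hu : u ∈ s) : ∃ r > (0 : ℝ), ∀ e : ℝ, 0 < e → e < r → (1 - e) • u + e • v ∈ openHull s := by
  obtain ⟨a, ha, ha0⟩ := hs.exists_pos hP he
  obtain ⟨b, hb, hb0⟩ := hs.exists_neg hP he
  have hab := ne_of_hgt_neg ha0 hb0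
  have hua := (ne_left_of_hgt ha0.ne').symm
  have hub := (ne_left_of_hgt hb0.ne).symm
  obtain ⟨z, ⟨x, y, hx, hy, hxy, hz⟩, x', y', hx', hy', hxy', hz'⟩ :=
    hs.exists_cross he ha hb ha0 hb0
  refine ⟨y, hy, fun e he0 her => ?_⟩
  rw [Finset.eq_three hs.1.1 ha hb hu hab hua hub]
  have h1 : e / y < 1 := (div_lt_one hy).2 her
  have h2 : 0 < e / y := div_pos he0 hy
  have := mem_openHull_three hab hua hub (mul_pos h2 hx') (mul_pos h2 hy') (sub_pos.2 h1)
    (by linear_combination (e / y) * hxy')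
  convert this using 1
  have e1 : (e / y * x') • a + (e / y * y') • b = (e / y) • z := by
    rw [← hz']
    module
  rw [e1, ← hz]
  obtain rfl : x = 1 - y := by linarith
  match_scalars <;> field_simp
  ring

lemma Hull.eq_of_left (hP : GenPos P) (he : NonDel P u v) (hs : Hull P u v s) (ht : Hull P u v t)
    (hus : u ∈ s) (hut : u ∈ t) : s = t := by
  obtain ⟨r, hr, h⟩ := hs.mem_openHull_of_left hP he hus
  obtain ⟨r', hr', h'⟩ := ht.mem_openHull_of_left hP he hut
  have h0 : 0 < min r r' / 2 := by positivity
  have h1 : min r r' / 2 < min r r' := by linarith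
  exact hs.1.eq_of_meet hP ht.1 (openHull_subset_triSet _ (h _ h0 (h1.trans_le (min_le_left _ _))))
    (h' _ h0 (h1.trans_le (min_le_right _ _)))

/-- `a` is the lower of the two vertices of `s` above `u v`, and the other one lies on the side of
the third edge through `a` indicated by the sign `r`. -/
def Mid (u v : Pt) (r : ℝ) (s : Finset Pt) (a : Pt) : Prop :=
  ∃ c b, a ∈ s ∧ c ∈ s ∧ b ∈ s ∧ 0 < hgt u v a ∧ hgt u v a ≤ hgt u v c ∧ hgt u v b < 0 ∧
    0 < r * hgt a b c

lemma Mid.pos {r : ℝ} (h : Mid u v r s a) : 0 < hgt u v a := by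
  obtain ⟨-, -, -, -, -, h, -⟩ := h
  exact h

lemma no_edge_of_le (hP : GenPos P) {r : ℝ} (hs : IsDel P s) (ht : IsDel P t) (ha : a ∈ s)
    (hc : c ∈ s) (hb : b ∈ s) (ha0 : 0 < hgt u v a) (hac : hgt u v a ≤ hgt u v c)
    (hb0 : hgt u v b < 0)
    (hr0 : 0 < r * hgt a b c) (hat : a ∈ t) (hd : d ∈ t) (hd0 : hgt u v d < 0) :
    r * hgt a b d ≤ 0 := by
  by_contra! hrd
  have habc : hgt a b c ≠ 0 := right_ne_zero_of_mul hr0.ne'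
  obtain ⟨x, y, w, hxyw, rfl⟩ := exists_comb habc d
  have hw : 0 < w := by
    rw [(hgt a b).map_comb₃ hxyw, hgt_left, hgt_right] at hrd
    refine pos_of_mul_pos_left (b := r * hgt a b c) ?_ hr0.le
    linarith
  have hy : 0 ≤ y := by
    by_contra! hy
    rw [(hgt u v).map_comb₃ hxyw] at hd0
    have h1 := mul_pos_of_neg_of_neg hy hb0
    have h2 := mul_le_mul_of_nonneg_left hac hw.le
    have h3 : (x + w) * hgt u v a < 0 := by linarith
    have h4 := neg_of_mul_neg_left h3 ha0.le
    linarith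
  set e : ℝ := 1 / (2 + |x|) with he
  have hx0 := abs_nonneg x
  have he0 : 0 < e := by positivity
  have he1 : e < 1 := by
    rw [he, div_lt_one (by positivity)]
    linarith
  have hex : 0 ≤ (1 - e) + e * x := by
    have h1 : e * (2 + |x|) = 1 := by
      rw [he]
      field_simp
    have := mul_le_mul_of_nonneg_left (neg_abs_le x) he0.le
    nlinarith
  have hne : a ≠ x • a + y • b + w • c := ne_of_hgt_neg ha0 hd0
  have hsub := hs.face_subset hP ht (B := {a, x • a + y • b + w • c})
    (by simp [Finset.insert_subset_iff, hat, hd])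
    (z := (1 - e) • a + e • (x • a + y • b + w • c))
    (by
      have := mem_triSet_three ha hb hc hex (mul_nonneg he0.le hy) (mul_pos he0 hw).le
        (by linear_combination e * hxyw)
      convert this using 1
      module)
    (by
      rw [openHull_pair hne]
      exact ⟨_, _, sub_pos.2 he1, he0, by ring, rfl⟩)
  have hds : x • a + y • b + w • c ∈ s := hsub (by simp)
  have hab := ne_of_hgt_neg ha0 hb0
  rw [Finset.eq_three hs.1 ha hb hc hab (ne_left_of_hgt habc) (ne_right_of_hgt habc)] at hds
  simp only [Finset.mem_insert, Finset.mem_singleton] at hds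
  rcases hds with h | h | h
  · exact hne h.symm
  · rw [h, hgt_right] at hrd
    linarith
  · rw [h] at hd0
    linarith

lemma IsDel.eq_of_same_side (hP : GenPos P) {r : ℝ} (hs : IsDel P s) (ht : IsDel P t) (ha : a ∈ s)
    (hb : b ∈ s) (hc : c ∈ s) (ha' : a ∈ t) (hb' : b ∈ t) (hd : d ∈ t) (hab : a ≠ b)
    (hr : 0 < r * hgt a b c) (hr' : 0 < r * hgt a b d) : s = t := by
  have hc0 : hgt a b c ≠ 0 := right_ne_zero_of_mul hr.ne'
  have hd0 : hgt a b d ≠ 0 := right_ne_zero_of_mul hr'.ne'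
  obtain ⟨x, y, w, hxyw, hcd⟩ := exists_comb hd0 c
  have hw : 0 < w := by
    rw [hcd, (hgt a b).map_comb₃ hxyw, hgt_left, hgt_right] at hr
    refine pos_of_mul_pos_left (b := r * hgt a b d) ?_ hr'.le
    linarith
  set e : ℝ := 1 / (2 + 2 * |x| + 2 * |y|) with he
  have hx0 := abs_nonneg x
  have hy0 := abs_nonneg y
  have he0 : 0 < e := by positivity
  have h1 : e * (2 + 2 * |x| + 2 * |y|) = 1 := by
    rw [he]
    field_simp
  have hex := mul_le_mul_of_nonneg_left (neg_abs_le x) he0.le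
  have hey := mul_le_mul_of_nonneg_left (neg_abs_le y) he0.le
  have hex' := mul_nonneg he0.le hx0
  have hey' := mul_nonneg he0.le hy0
  have hmem := mem_openHull_three hab (ne_left_of_hgt hc0) (ne_right_of_hgt hc0)
    (x := (1 - e) / 2) (y := (1 - e) / 2) (w := e) (by linarith) (by linarith) he0 (by ring)
  rw [← Finset.eq_three hs.1 ha hb hc hab (ne_left_of_hgt hc0) (ne_right_of_hgt hc0)] at hmem
  refine (ht.eq_of_meet hP hs ?_ hmem).symm
  have := mem_triSet_three (x := (1 - e) / 2 + e * x) (y := (1 - e) / 2 + e * y) (w := e * w)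
    ha' hb' hd (by linarith) (by linarith) (mul_pos he0 hw).le
    (by linear_combination e * hxyw)
  convert this using 1
  rw [hcd]
  module

lemma Mid.eq (hP : GenPos P) {r : ℝ} (hs : IsDel P s) (ht : IsDel P t) (hsa : Mid u v r s a)
    (hta : Mid u v r t a) : s = t := by
  obtain ⟨c, b, ha, hc, hb, ha0, hac, hb0, hr⟩ := hsa
  obtain ⟨c', b', ha', hc', hb', -, hac', hb0', hr'⟩ := hta
  have h1 := no_edge_of_le hP hs ht ha hc hb ha0 hac hb0 hr ha' hb' hb0'
  have h2 := no_edge_of_le hP ht hs ha' hc' hb' ha0 hac' hb0' hr' ha hb hb0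
  have h3 : hgt a b' b = -hgt a b b' := by
    rw [hgt_apply, hgt_apply]
    ring
  rw [h3] at h2
  have h0 : hgt a b b' = 0 :=
    (mul_eq_zero.1 (h1.antisymm (by linarith))).resolve_left (left_ne_zero_of_mul hr.ne')
  obtain h | rfl := hP.eq_of_hgt (hs.2.1 ha) (hs.2.1 hb) (ne_of_hgt_neg ha0 hb0) (ht.2.1 hb') h0
  · exact absurd h.symm (ne_of_hgt_neg ha0 hb0')
  · exact hs.eq_of_same_side hP ht ha hb hc ha' hb' hc' (ne_of_hgt_neg ha0 hb0) hr hr'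

lemma Lens.exists_mid (hP : GenPos P) (hE : Lens P k u v g g') (hs : Hull P u v s) (hus : u ∉ s)
    (hvs : v ∉ s) : ∃ a ∈ lens P g g', ∃ r ∈ ({1, -1} : Finset ℝ),
      Mid u v r s a ∨ Mid v u r s a := by
  have key : ∀ {u v g g'}, Lens P k u v g g' → Hull P u v s → ∀ a b c, a ∈ s → b ∈ s → c ∈ s →
      c ≠ a → 0 < hgt u v a → hgt u v b < 0 → hgt u v a ≤ hgt u v c →
      ∃ a ∈ lens P g g', ∃ r ∈ ({1, -1} : Finset ℝ), Mid u v r s a := by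
    intro u v g g' hE hs a b c ha hb hc hca ha0 hb0 hac
    obtain ⟨z, hz, hzab⟩ := hs.exists_cross hE.nonDel ha hb ha0 hb0
    have hcb := ne_of_hgt_neg (ha0.trans_le hac) hb0
    have hne := hP.hgt_ne (hs.1.2.1 ha) (hs.1.2.1 hb) (hs.1.2.1 hc) (ne_of_hgt_neg ha0 hb0)
      hca.symm hcb.symm
    refine ⟨a, hE.mem_of_cross hP hs.1 ha hb (mul_neg_of_pos_of_neg ha0 hb0) hz hzab, ?_⟩
    rcases lt_or_gt_of_ne hne with h | h
    · exact ⟨-1, by simp, c, b, ha, hc, hb, ha0, hac, hb0, by linarith⟩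
    · exact ⟨1, by simp, c, b, ha, hc, hb, ha0, hac, hb0, by linarith⟩
  have key' : ∀ {u v g g'}, Lens P k u v g g' → Hull P u v s → ∀ a b c, a ∈ s → b ∈ s → c ∈ s →
      c ≠ a → 0 < hgt u v a → hgt u v b < 0 → 0 < hgt u v c →
      ∃ a ∈ lens P g g', ∃ r ∈ ({1, -1} : Finset ℝ), Mid u v r s a := by
    intro u v g g' hE hs a b c ha hb hc hca ha0 hb0 hc0
    rcases le_total (hgt u v a) (hgt u v c) with h | h
    · exact key hE hs a b c ha hb hc hca ha0 hb0 h
    · exact key hE hs c b a hc hb ha hca.symm hc0 hb0 h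
  obtain ⟨a, ha, ha0⟩ := hs.exists_pos hP hE.nonDel
  obtain ⟨b, hb, hb0⟩ := hs.exists_neg hP hE.nonDel
  obtain ⟨c, hca, hcb, hsabc⟩ := Finset.exists_third hs.1.1 ha hb (ne_of_hgt_neg ha0 hb0)
  have hc : c ∈ s := by
    rw [hsabc]
    simp
  have hc0 : hgt u v c ≠ 0 := fun h => by
    rcases hP.eq_of_hgt hE.nonDel.left hE.nonDel.right hE.nonDel.ne (hs.1.2.1 hc) h with rfl | rfl
    · exact hus hc
    · exact hvs hc
  rcases lt_or_gt_of_ne hc0 with h | h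
  · obtain ⟨p, hp, r, hr, hm⟩ := key' hE.symm hs.symm b a c hb ha hc hcb
      (by rw [hgt_swap]; linarith) (by rw [hgt_swap]; linarith) (by rw [hgt_swap]; linarith)
    exact ⟨p, lens_comm ▸ hp, r, hr, Or.inr hm⟩
  · obtain ⟨p, hp, r, hr, hm⟩ := key' hE hs a b c ha hb hc hca ha0 hb0 h
    exact ⟨p, hp, r, hr, Or.inl hm⟩

lemma finite_hull (hfin : P.Finite) : {s | Hull P u v s}.Finite :=
  (finite_isDel hfin).subset fun _ h => h.1

lemma Lens.ncard_hull_le (hfin : P.Finite) (hP : GenPos P) (hE : Lens P k u v g g') :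
    {s | Hull P u v s}.ncard ≤ 4 * k + 2 := by
  classical
  set H := (finite_hull (u := u) (v := v) hfin).toFinset with hH
  have hmem : ∀ s, s ∈ H ↔ Hull P u v s := fun s => by simp [hH]
  set W := (finite_lens (g := g) (g' := g') hfin).toFinset with hW
  have hWc : W.card ≤ 2 * k := by
    rw [← Set.ncard_eq_toFinset_card _ (finite_lens hfin)]
    exact hE.ncard_le hfin
  rw [Set.ncard_eq_toFinset_card _ (finite_hull hfin), ← hH]
  have hsub : H ⊆ H.filter (u ∈ ·) ∪ H.filter (v ∈ ·) ∪ (W ×ˢ ({1, -1} : Finset ℝ)).biUnion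
      (fun p => {s ∈ H | Mid u v p.2 s p.1 ∨ Mid v u p.2 s p.1}) := by
    intro s hs
    have hs' := (hmem s).1 hs
    simp only [Finset.mem_union, Finset.mem_filter, Finset.mem_biUnion, Finset.mem_product, hs,
      true_and]
    by_cases hu : u ∈ s
    · exact Or.inl (Or.inl hu)
    by_cases hv : v ∈ s
    · exact Or.inl (Or.inr hv)
    obtain ⟨a, ha, r, hr, h⟩ := hE.exists_mid hP hs' hu hv
    exact Or.inr ⟨(a, r), ⟨by simpa [hW] using ha, hr⟩, h⟩
  have h1 : (H.filter (u ∈ ·)).card ≤ 1 := Finset.card_le_one.2 fun s hs t ht => by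
    simp only [Finset.mem_filter, hmem] at hs ht
    exact hs.1.eq_of_left hP hE.nonDel ht.1 hs.2 ht.2
  have h2 : (H.filter (v ∈ ·)).card ≤ 1 := Finset.card_le_one.2 fun s hs t ht => by
    simp only [Finset.mem_filter, hmem] at hs ht
    exact hs.1.symm.eq_of_left hP hE.nonDel.symm ht.1.symm hs.2 ht.2
  have h3 := Finset.card_biUnion_le_card_mul (W ×ˢ ({1, -1} : Finset ℝ))
    (fun p => {s ∈ H | Mid u v p.2 s p.1 ∨ Mid v u p.2 s p.1}) 1 fun p _ =>
    Finset.card_le_one.2 fun s hs t ht => by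
      simp only [Finset.mem_filter, hmem] at hs ht
      rcases hs.2 with h | h <;> rcases ht.2 with h' | h'
      · exact h.eq hP hs.1.1 ht.1.1 h'
      · have := h.pos
        have := h'.pos
        rw [hgt_swap] at this
        linarith
      · have := h.pos
        have := h'.pos
        rw [hgt_swap] at this
        linarith
      · exact h.eq hP hs.1.1 ht.1.1 h'
  have h4 : ({1, -1} : Finset ℝ).card ≤ 2 := Finset.card_le_two
  rw [Finset.card_product] at h3
  have h5 := Finset.card_le_card hsub
  have h6 := Finset.card_union_le (H.filter (u ∈ ·) ∪ H.filter (v ∈ ·))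
    ((W ×ˢ ({1, -1} : Finset ℝ)).biUnion
      (fun p => {s ∈ H | Mid u v p.2 s p.1 ∨ Mid v u p.2 s p.1}))
  have h7 := Finset.card_union_le (H.filter (u ∈ ·)) (H.filter (v ∈ ·))
  have h8 := Nat.mul_le_mul hWc h4
  omega

end

/-- The open segments `u v` and `a b` cross, with `u` to the left of `a b`. -/
def Cross (u v a b : Pt) : Prop :=
  0 < hgt a b u ∧ hgt a b v < 0 ∧ (openSegment ℝ u v ∩ openSegment ℝ a b).Nonempty

/-- The slope of the plane through the lifts of `a`, `b`, `p` relative to the graph of `f`. -/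
def liftSlope (f : AffFn) (a b p : Pt) : ℝ := (sqn p - f p) / hgt a b p

/-- The points of `P` to the left of `a b` whose slope is below that of `p`. -/
def below (P : Set Pt) (f : AffFn) (a b p : Pt) : Set Pt :=
  {q ∈ P | 0 < hgt a b q ∧ liftSlope f a b q < liftSlope f a b p}

/-- The pairs with order-`k` caps that cross `a b`. -/
def crossing (P : Set Pt) (k : ℕ) (a b : Pt) : Set (Finset Pt) :=
  {e | ∃ u v, e = {u, v} ∧ (∃ g g', Lens P k u v g g') ∧ Cross u v a b}

section

variable {P : Set Pt} {k : ℕ} {u v a b c p q : Pt} {g g' f : AffFn} {s : Finset Pt}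

lemma Cross.symm (h : Cross u v a b) : Cross v u b a := by
  obtain ⟨h1, h2, h3⟩ := h
  refine ⟨?_, ?_, ?_⟩
  · rw [hgt_swap]
    linarith
  · rw [hgt_swap]
    linarith
  · rwa [openSegment_symm ℝ v u, openSegment_symm ℝ b a]

lemma crossing_comm : crossing P k a b = crossing P k b a := by
  have key : ∀ a b, crossing P k a b ⊆ crossing P k b a := by
    rintro a b e ⟨u, v, rfl, ⟨g, g', h⟩, hc⟩
    exact ⟨v, u, Finset.pair_comm u v, ⟨g', g, h.symm⟩, hc.symm⟩
  exact (key a b).antisymm (key b a)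

lemma mul_hgt_neg_of_cross {z : Pt} (hz : z ∈ openSegment ℝ u v) (hzab : z ∈ openSegment ℝ a b)
    (ha : hgt u v a ≠ 0) : hgt u v a * hgt u v b < 0 := by
  have h0 := hgt_openSegment hz
  obtain ⟨x, y, hx, hy, hxy, rfl⟩ := hzab
  rw [(hgt u v).map_comb hxy] at h0
  have h1 : y * (hgt u v a * hgt u v b) = -(x * (hgt u v a * hgt u v a)) := by
    linear_combination hgt u v a * h0
  have h2 := mul_pos hx (mul_self_pos.2 ha)
  by_contra! hcon
  have := mul_nonneg hy.le hcon
  linarith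

lemma Lens.mem_lens_of_above (hP : GenPos P) (hE : Lens P k u v g g') (hs : IsDel P s) (ha : a ∈ s)
    (hb : b ∈ s) (ha0 : 0 < hgt u v a) (hb0 : hgt u v b < 0) {z : Pt}
    (hz : z ∈ openSegment ℝ u v) (hzab : z ∈ openSegment ℝ a b) {L : AffFn} (hLa : L a = sqn a)
    (hLb : L b = sqn b) (hLu : L u = sqn u) (hLv : L v ≤ sqn v) {x y w : ℝ} (hxyw : x + y + w = 1)
    (hx : 0 < x) (hq : q = x • u + y • a + w • b) (hqP : q ∈ P) (hqL : sqn q < L q) :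
    q ∈ lens P g g' := by
  obtain ⟨hgu, hgv, hgP, -⟩ := hE.cap
  obtain ⟨hgv', hgu', hgP', -⟩ := hE.cap'
  have haP := hs.2.1 ha
  have hbP := hs.2.1 hb
  rcases le_or_gt 0 (hgt u v q) with h | h
  · exact ⟨hqP, Or.inr (sqn_lt_of_cross hLa hLb hLu hgu' (hLv.trans hgv'.ge)
      (hE.lt_of_cross hP hs ha hb hb0 hz hzab) (hgP' b hbP (by rw [hgt_swap]; linarith))
      (hgt_left u v) (hgt_right u v) ha0 hz hzab hxyw hx hq hqL h)⟩
  · have hzba := openSegment_symm ℝ a b ▸ hzab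
    refine ⟨hqP, Or.inl (sqn_lt_of_cross (h := hgt v u) (y := w) (w := y) hLb hLa hLu hgu
      (hLv.trans hgv.ge) (hE.symm.lt_of_cross hP hs hb ha (by rw [hgt_swap]; linarith)
        (openSegment_symm ℝ u v ▸ hz) hzba) (hgP a haP ha0.le)
      (hgt_right v u) (hgt_left v u) (by rw [hgt_swap]; linarith) hz hzba (by linarith) hx ?_ hqL
      (by rw [hgt_swap]; linarith))⟩
    rw [hq]
    abel

lemma AffFn.add_smul_apply (f h : AffFn) (r : ℝ) (x : Pt) : (f + r • h) x = f x + r * h x := by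
  simp

lemma Lens.below_subset (hP : GenPos P) (hE : Lens P k u v g g') (hs : IsDel P s)
    (hf : ∀ i ∈ s, f i = sqn i) (hf' : ∀ i ∈ P, f i ≤ sqn i) (ha : a ∈ s) (hb : b ∈ s)
    (hc : Cross u v a b) : below P f a b u ⊆ lens P g g' := by
  rintro q ⟨hqP, hq0, hqu⟩
  obtain ⟨hu0, hv0, z, hz, hzab⟩ := hc
  have hd := hE.nonDel
  set L := f + liftSlope f a b u • hgt a b with hL
  have hLa : L a = sqn a := by
    rw [hL, AffFn.add_smul_apply, hgt_left, hf a ha, mul_zero, add_zero]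
  have hLb : L b = sqn b := by
    rw [hL, AffFn.add_smul_apply, hgt_right, hf b hb, mul_zero, add_zero]
  have hLu : L u = sqn u := by
    rw [hL, AffFn.add_smul_apply, liftSlope, div_mul_cancel₀ _ hu0.ne']
    ring
  have hLv : L v ≤ sqn v := by
    rw [hL, AffFn.add_smul_apply]
    have h1 : 0 ≤ liftSlope f a b u := div_nonneg (sub_nonneg.2 (hf' u hd.left)) hu0.le
    have h2 := mul_nonpos_of_nonneg_of_nonpos h1 hv0.le
    have h3 := hf' v hd.right
    linarith
  have hLq : sqn q < L q := by
    rw [hL, AffFn.add_smul_apply]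
    rw [liftSlope, div_lt_iff₀ hq0] at hqu
    linarith
  obtain ⟨x, y, w, hxyw, hq⟩ := exists_comb (a := u) (b := a) (c := b)
    (by rw [← hgt_rot]; exact hu0.ne') q
  have hx : 0 < x := by
    rw [hq, (hgt a b).map_comb₃ hxyw, hgt_left, hgt_right] at hq0
    refine pos_of_mul_pos_left (b := hgt a b u) ?_ hu0.le
    linarith
  have hau : a ≠ u := (ne_left_of_hgt hu0.ne').symm
  have hav : a ≠ v := (ne_left_of_hgt hv0.ne).symm
  have ha0 : hgt u v a ≠ 0 := hP.hgt_ne hd.left hd.right (hs.2.1 ha) hd.ne hau.symm hav.symm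
  rcases mul_neg_iff.1 (mul_hgt_neg_of_cross hz hzab ha0) with ⟨h1, h2⟩ | ⟨h1, h2⟩
  · exact hE.mem_lens_of_above hP hs ha hb h1 h2 hz hzab hLa hLb hLu hLv hxyw hx hq hqP hLq
  · refine hE.mem_lens_of_above hP hs hb ha h2 h1 hz (openSegment_symm ℝ a b ▸ hzab) hLb hLa hLu hLv
      (y := w) (w := y) (by linarith) hx ?_ hqP hLq
    rw [hq]
    abel

lemma finite_below (hfin : P.Finite) : (below P f a b p).Finite := hfin.subset fun _ hq => hq.1

lemma Lens.ncard_below_add_le (hfin : P.Finite) (hP : GenPos P) (hE : Lens P k u v g g')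
    (hs : IsDel P s) (hf : ∀ i ∈ s, f i = sqn i) (hf' : ∀ i ∈ P, f i ≤ sqn i) (ha : a ∈ s)
    (hb : b ∈ s) (hab : a ≠ b) (hc : Cross u v a b) :
    (below P f a b u).ncard + (below P f b a v).ncard + 2 ≤ 2 * k := by
  have h1 := hE.below_subset hP hs hf hf' ha hb hc
  have h2 := hE.symm.below_subset hP hs hf hf' hb ha hc.symm
  rw [lens_comm] at h2
  have hd := hE.nonDel
  obtain ⟨hu0, hv0, z, hz, hzab⟩ := hc
  have hau : a ≠ u := (ne_left_of_hgt hu0.ne').symm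
  have hav : a ≠ v := (ne_left_of_hgt hv0.ne).symm
  have ha0 : hgt u v a ≠ 0 := hP.hgt_ne hd.left hd.right (hs.2.1 ha) hd.ne hau.symm hav.symm
  have hneg := mul_hgt_neg_of_cross hz hzab ha0
  have ha1 := hE.mem_of_cross hP hs ha hb hneg hz hzab
  have hb1 := hE.mem_of_cross hP hs hb ha (by rwa [mul_comm]) hz (openSegment_symm ℝ a b ▸ hzab)
  have hsub : (below P f a b u ∪ below P f b a v) ∪ {a, b} ⊆ lens P g g' :=
    union_subset (union_subset h1 h2) (insert_subset ha1 (singleton_subset_iff.2 hb1))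
  have hd1 : Disjoint (below P f a b u) (below P f b a v) := disjoint_left.2 fun q hq hq' => by
    have h1 := hq.2.1
    have h2 := hq'.2.1
    rw [hgt_swap] at h2
    linarith
  have hd2 : Disjoint (below P f a b u ∪ below P f b a v) {a, b} := by
    refine disjoint_left.2 fun q hq hq' => ?_
    simp only [mem_insert_iff, mem_singleton_iff] at hq'
    have h0 : hgt a b q = 0 := by
      rcases hq' with rfl | rfl
      · exact hgt_left _ _
      · exact hgt_right _ _
    rcases hq with hq | hq
    · exact hq.2.1.ne' h0
    · have := hq.2.1
      rw [hgt_swap, h0] at this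
      linarith
  have h3 := ncard_le_ncard hsub (finite_lens hfin)
  rw [ncard_union_eq hd2 ((finite_below hfin).union (finite_below hfin)) (toFinite _),
    ncard_union_eq hd1 (finite_below hfin) (finite_below hfin), ncard_pair hab] at h3
  exact h3.trans (hE.ncard_le hfin)

lemma eq_of_ncard_below_eq (hfin : P.Finite) (hP : GenPos P) (haP : a ∈ P) (hbP : b ∈ P)
    (ha : f a = sqn a) (hb : f b = sqn b) (hab : a ≠ b) (hp : p ∈ P) (hq : q ∈ P)
    (hp0 : 0 < hgt a b p) (hq0 : 0 < hgt a b q)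
    (h : (below P f a b p).ncard = (below P f a b q).ncard) : p = q := by
  have key : ∀ p q, p ∈ P → 0 < hgt a b p → liftSlope f a b p < liftSlope f a b q →
      (below P f a b p).ncard < (below P f a b q).ncard := fun p q hp hp0 hlt => by
    have hsub : below P f a b p ⊆ below P f a b q := fun r hr =>
      ⟨hr.1, hr.2.1, hr.2.2.trans hlt⟩
    exact ncard_lt_ncard ((ssubset_iff_of_subset hsub).2
      ⟨p, ⟨hp, hp0, hlt⟩, fun hpp => lt_irrefl _ hpp.2.2⟩) (finite_below hfin)
  have hslope : liftSlope f a b p = liftSlope f a b q := by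
    rcases lt_trichotomy (liftSlope f a b p) (liftSlope f a b q) with h' | h' | h'
    · exact absurd h (key p q hp hp0 h').ne
    · exact h'
    · exact absurd h (key q p hq hq0 h').ne'
  have hpa := ne_left_of_hgt hp0.ne'
  have hpb := ne_right_of_hgt hp0.ne'
  have hL : ∀ r, 0 < hgt a b r → (f + liftSlope f a b r • hgt a b) r = sqn r := fun r hr => by
    rw [AffFn.add_smul_apply, liftSlope, div_mul_cancel₀ _ hr.ne']
    ring
  have := hP.mem_of_eq (t := {a, b, p}) (f := f + liftSlope f a b p • hgt a b)
    (Finset.card_eq_three.2 ⟨a, b, p, hab, hpa.symm, hpb.symm, rfl⟩)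
    (by simp [insert_subset_iff, haP, hbP, hp]) (fun i hi => by
      simp only [Finset.mem_insert, Finset.mem_singleton] at hi
      rcases hi with rfl | rfl | rfl
      · rw [AffFn.add_smul_apply, hgt_left, ha, mul_zero, add_zero]
      · rw [AffFn.add_smul_apply, hgt_right, hb, mul_zero, add_zero]
      · exact hL _ hp0) hq (by rw [hslope]; exact hL q hq0)
  simp only [Finset.mem_insert, Finset.mem_singleton] at this
  rcases this with rfl | rfl | rfl
  · exact absurd rfl (ne_left_of_hgt hq0.ne')
  · exact absurd rfl (ne_right_of_hgt hq0.ne')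
  · rfl

/-- The ordered pairs with order-`k` caps that cross `a b` from left to right. -/
def crossPairs (P : Set Pt) (k : ℕ) (a b : Pt) : Set (Pt × Pt) :=
  {x | (∃ g g', Lens P k x.1 x.2 g g') ∧ Cross x.1 x.2 a b}

lemma finite_crossPairs (hfin : P.Finite) : (crossPairs P k a b).Finite :=
  (hfin.prod hfin).subset fun _ ⟨⟨_, _, h⟩, _⟩ => ⟨h.nonDel.left, h.nonDel.right⟩

lemma crossing_eq_image :
    crossing P k a b = (fun x : Pt × Pt => {x.1, x.2}) '' crossPairs P k a b := by
  ext e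
  constructor
  · rintro ⟨u, v, rfl, h⟩
    exact ⟨(u, v), h, rfl⟩
  · rintro ⟨⟨u, v⟩, h, rfl⟩
    exact ⟨u, v, rfl, h⟩

lemma finite_crossing (hfin : P.Finite) : (crossing P k a b).Finite := by
  rw [crossing_eq_image]
  exact (finite_crossPairs hfin).image _

lemma card_biUnion_antidiagonal_le (n : ℕ) :
    2 * ((Finset.range n).biUnion (fun i => Finset.HasAntidiagonal.antidiagonal i)).card ≤
      n * (n + 1) := by
  have h : 2 * ∑ i ∈ Finset.range n, (i + 1) = n * (n + 1) := by
    induction n with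
    | zero => rfl
    | succ n ih =>
      rw [Finset.sum_range_succ, mul_add, ih]
      ring
  rw [← h]
  refine Nat.mul_le_mul_left 2 (Finset.card_biUnion_le.trans (Finset.sum_le_sum fun i _ => ?_))
  rw [Finset.Nat.card_antidiagonal]

lemma ncard_crossing_le (hfin : P.Finite) (hP : GenPos P) (hs : IsDel P s) (ha : a ∈ s)
    (hb : b ∈ s) (hab : a ≠ b) : (crossing P k a b).ncard ≤ k * (2 * k - 1) := by
  obtain ⟨h3, hsP, f, hf, hf'⟩ := id hs
  rw [crossing_eq_image]
  refine (ncard_image_le (finite_crossPairs hfin)).trans ?_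
  have h1 : (crossPairs P k a b).ncard ≤
      ((Finset.range (2 * k - 1)).biUnion
        (fun i => Finset.HasAntidiagonal.antidiagonal i)).card := by
    rw [← ncard_coe_finset]
    refine ncard_le_ncard_of_injOn
      (fun x => ((below P f a b x.1).ncard, (below P f b a x.2).ncard)) ?_ ?_
      (Finset.finite_toSet _)
    · rintro ⟨u, v⟩ ⟨⟨g, g', hE⟩, hc⟩
      have := hE.ncard_below_add_le hfin hP hs hf hf' ha hb hab hc
      exact Finset.mem_coe.2 (Finset.mem_biUnion.2
        ⟨_, Finset.mem_range.2 (by omega), Finset.HasAntidiagonal.mem_antidiagonal.2 rfl⟩)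
    · rintro ⟨u, v⟩ ⟨⟨g, g', hE⟩, hc⟩ ⟨u', v'⟩ ⟨⟨_, _, hE'⟩, hc'⟩ h
      simp only [Prod.mk.injEq] at h ⊢
      exact ⟨eq_of_ncard_below_eq hfin hP (hsP ha) (hsP hb) (hf a ha) (hf b hb) hab hE.nonDel.left
          hE'.nonDel.left hc.1 hc'.1 h.1,
        eq_of_ncard_below_eq hfin hP (hsP hb) (hsP ha) (hf b hb) (hf a ha) hab.symm hE.nonDel.right
          hE'.nonDel.right hc.symm.1 hc'.symm.1 h.2⟩
  have h2 := card_biUnion_antidiagonal_le (2 * k - 1)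
  rcases Nat.eq_zero_or_pos k with rfl | hk
  · simpa using h1
  · rw [Nat.sub_add_cancel (by omega)] at h2
    refine h1.trans (Nat.le_of_mul_le_mul_left (c := 2) ?_ two_pos)
    linarith

lemma ncard_crossing_through_le (hfin : P.Finite) (hP : GenPos P) (hs : IsDel P s) (ha : a ∈ s)
    (hb : b ∈ s) (hab : a ≠ b) (c : Pt) :
    {e ∈ crossing P k a b | c ∈ e}.ncard ≤ 2 * k - 1 := by
  wlog hc0 : 0 ≤ hgt a b c generalizing a b
  · rw [crossing_comm]
    exact this hb ha hab.symm (by rw [hgt_swap]; linarith)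
  obtain ⟨h3, hsP, f, hf, hf'⟩ := id hs
  have hsub : {e ∈ crossing P k a b | c ∈ e} ⊆
      (fun x : Pt × Pt => {x.1, x.2}) '' {x ∈ crossPairs P k a b | x.1 = c} := by
    rintro e ⟨⟨u, v, rfl, hE, hc⟩, hce⟩
    refine ⟨(u, v), ⟨⟨hE, hc⟩, ?_⟩, rfl⟩
    simp only [Finset.mem_insert, Finset.mem_singleton] at hce
    rcases hce with rfl | rfl
    · rfl
    · exact absurd hc.2.1 (not_lt.2 hc0)
  have hfin' : {x ∈ crossPairs P k a b | x.1 = c}.Finite :=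
    (finite_crossPairs hfin).subset fun _ h => h.1
  refine (ncard_le_ncard hsub (hfin'.image _)).trans ((ncard_image_le hfin').trans ?_)
  rw [← Finset.card_range (2 * k - 1), ← ncard_coe_finset]
  refine ncard_le_ncard_of_injOn (fun x => (below P f b a x.2).ncard) ?_ ?_ (Finset.finite_toSet _)
  · rintro ⟨u, v⟩ ⟨⟨⟨g, g', hE⟩, hc⟩, -⟩
    have := hE.ncard_below_add_le hfin hP hs hf hf' ha hb hab hc
    rw [Finset.mem_coe, Finset.mem_range]
    omega
  · rintro ⟨u, v⟩ ⟨⟨⟨g, g', hE⟩, hc⟩, hu⟩ ⟨u', v'⟩ ⟨⟨⟨_, _, hE'⟩, hc'⟩, hu'⟩ h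
    simp only at h hu hu'
    rw [Prod.mk.injEq, hu, hu']
    exact ⟨rfl, eq_of_ncard_below_eq hfin hP (hsP hb) (hsP ha) (hf b hb) (hf a ha) hab.symm
      hE.nonDel.right hE'.nonDel.right hc.symm.1 hc'.symm.1 h⟩

lemma Lens.mem_crossing (hP : GenPos P) (hE : Lens P k u v g g') (hs : Hull P u v s) (ha : a ∈ s)
    (hb : b ∈ s) (ha0 : 0 < hgt u v a) (hb0 : hgt u v b < 0) : {u, v} ∈ crossing P k a b := by
  have hd := hE.nonDel
  obtain ⟨z, hz, hzab⟩ := hs.exists_cross hd ha hb ha0 hb0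
  have hua := (ne_left_of_hgt ha0.ne').symm
  have hub := (ne_left_of_hgt hb0.ne).symm
  have hu0 := hP.hgt_ne (hs.1.2.1 ha) (hs.1.2.1 hb) hd.left (ne_of_hgt_neg ha0 hb0)
    hua.symm hub.symm
  rcases mul_neg_iff.1 (mul_hgt_neg_of_cross hzab hz hu0) with ⟨h1, h2⟩ | ⟨h1, h2⟩
  · exact ⟨u, v, rfl, ⟨g, g', hE⟩, h1, h2, z, hz, hzab⟩
  · rw [crossing_comm]
    refine ⟨u, v, rfl, ⟨g, g', hE⟩, ?_, ?_, z, hz, openSegment_symm ℝ a b ▸ hzab⟩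
    · rw [hgt_swap]
      linarith
    · rw [hgt_swap]
      linarith

lemma ncard_lens_through_le (hfin : P.Finite) (hP : GenPos P) (hs : IsDel P s) :
    {e : Finset Pt | ∃ u v, e = {u, v} ∧ (∃ g g', Lens P k u v g g') ∧ Hull P u v s}.ncard ≤
      2 * (k * (2 * k - 1)) + (2 * k - 1) := by
  obtain ⟨x, y, c, hxy, hxc, hyc, hs3⟩ := Finset.card_eq_three.1 hs.1
  have hx : x ∈ s := by simp [hs3]
  have hy : y ∈ s := by simp [hs3]
  have hc : c ∈ s := by simp [hs3]
  have hsub : {e : Finset Pt | ∃ u v, e = {u, v} ∧ (∃ g g', Lens P k u v g g') ∧ Hull P u v s} ⊆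
      (crossing P k x c ∪ crossing P k y c) ∪ {e ∈ crossing P k x y | c ∈ e} := by
    rintro e ⟨u, v, rfl, ⟨g, g', hE⟩, hH⟩
    have hd := hE.nonDel
    obtain ⟨a, ha, ha0⟩ := hH.exists_pos hP hd
    obtain ⟨b, hb, hb0⟩ := hH.exists_neg hP hd
    have hab := ne_of_hgt_neg ha0 hb0
    have hmem := hE.mem_crossing hP hH ha hb ha0 hb0
    have hmem' : {u, v} ∈ crossing P k b a := by rwa [crossing_comm]
    have hthird : {u, v} ∈ crossing P k a c ∨ {u, v} ∈ crossing P k b c ∨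
        c ∈ ({u, v} : Finset Pt) := by
      rcases lt_trichotomy (hgt u v c) 0 with h | h | h
      · exact Or.inl (hE.mem_crossing hP hH ha hc ha0 h)
      · refine Or.inr (Or.inr ?_)
        simpa using hP.eq_of_hgt hd.left hd.right hd.ne (hs.2.1 hc) h
      · rw [crossing_comm (a := b)]
        exact Or.inr (Or.inl (hE.mem_crossing hP hH hc hb h hb0))
    rw [hs3] at ha hb
    simp only [Finset.mem_insert, Finset.mem_singleton] at ha hb
    rcases ha with rfl | rfl | rfl <;> rcases hb with rfl | rfl | rfl
    · exact absurd rfl hab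
    · rcases hthird with h | h | h
      · exact Or.inl (Or.inl h)
      · exact Or.inl (Or.inr h)
      · exact Or.inr ⟨hmem, h⟩
    · exact Or.inl (Or.inl hmem)
    · rcases hthird with h | h | h
      · exact Or.inl (Or.inr h)
      · exact Or.inl (Or.inl h)
      · exact Or.inr ⟨hmem', h⟩
    · exact absurd rfl hab
    · exact Or.inl (Or.inr hmem)
    · exact Or.inl (Or.inl hmem')
    · exact Or.inl (Or.inr hmem')
    · exact absurd rfl hab
  have h1 := ncard_le_ncard hsub (((finite_crossing hfin).union (finite_crossing hfin)).union
    ((finite_crossing hfin).subset fun _ h => h.1))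
  have h2 := ncard_union_le (crossing P k x c ∪ crossing P k y c) {e ∈ crossing P k x y | c ∈ e}
  have h3 := ncard_union_le (crossing P k x c) (crossing P k y c)
  have h4 := ncard_crossing_le (k := k) hfin hP hs hx hc hxc
  have h5 := ncard_crossing_le (k := k) hfin hP hs hy hc hyc
  have h6 := ncard_crossing_through_le (k := k) hfin hP hs hx hy hxy c
  omega

end

/-- If each of the sets `H e` has at most `m` elements and each element lies in at most `d` of
them, a positive fraction of them is pairwise disjoint. -/
lemma Finset.exists_pairwiseDisjoint_card_le {α β : Type*} [DecidableEq α] [DecidableEq β]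
    (E : Finset α) (H : α → Finset β) (hne : ∀ e ∈ E, (H e).Nonempty) {m d : ℕ}
    (hm : ∀ e ∈ E, (H e).card ≤ m) (hd : ∀ s, (E.filter fun e => s ∈ H e).card ≤ d) :
    ∃ F ⊆ E, (F : Set α).PairwiseDisjoint H ∧ E.card ≤ F.card * (m * d) := by
  classical
  obtain ⟨F, hF, hmax⟩ := Finset.exists_max_image
    (E.powerset.filter fun F : Finset α => (F : Set α).PairwiseDisjoint H) Finset.card ⟨∅, by simp⟩
  simp only [Finset.mem_filter, Finset.mem_powerset] at hF hmax
  refine ⟨F, hF.1, hF.2, ?_⟩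
  have hsub : E ⊆ F.biUnion fun e => (H e).biUnion fun s => E.filter fun e' => s ∈ H e' := by
    intro e he
    by_contra hcon
    simp only [Finset.mem_biUnion, Finset.mem_filter, not_exists, not_and] at hcon
    have hdis : ∀ e' ∈ F, Disjoint (H e') (H e) := fun e' he' =>
      Finset.disjoint_left.2 fun s hs hs' => hcon e' he' s hs he hs'
    have heF : e ∉ F := fun h => by
      obtain ⟨s, hs⟩ := hne e he
      exact Finset.disjoint_left.1 (hdis e h) hs hs
    have h := hmax (insert e F) ⟨Finset.insert_subset he hF.1, by
      rw [Finset.coe_insert]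
      exact hF.2.insert fun e' he' _ => (hdis e' he').symm⟩
    rw [Finset.card_insert_of_notMem heF] at h
    omega
  exact (Finset.card_le_card hsub).trans (Finset.card_biUnion_le_card_mul _ _ _ fun e he =>
    (Finset.card_biUnion_le_card_mul _ _ _ fun s _ => hd s).trans
      (Nat.mul_le_mul_right d (hm e (hF.1 he))))

section

variable {P : Set Pt} {k : ℕ} {u v : Pt}

lemma UsefulEdge.symm (h : UsefulEdge P k u v) : UsefulEdge P k v u := by
  obtain ⟨T, hT, t, ht, hu, hv⟩ := h
  exact ⟨T, hT, t, ht, hv, hu⟩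

lemma UsefulEdge.exists_hull (hfin : P.Finite) (hP : GenPos P) (huv : u ≠ v)
    (h : UsefulEdge P k u v) : ∃ s, Hull P u v s := by
  obtain ⟨T, hT, t, ht, hut, hvt⟩ := h
  obtain ⟨h3, htP⟩ := hT.1.2.1 t ht
  obtain ⟨s, hs, -⟩ := exists_hull_meet hfin hP huv h3 htP hut hvt
  exact ⟨s, hs⟩

lemma UsefulEdge.exists_lens (hfin : P.Finite) (hP : GenPos P) (hu : u ∈ P) (hv : v ∈ P)
    (huv : u ≠ v) (h : UsefulEdge P k u v) (h0 : ¬ UsefulEdge P 0 u v) :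
    ∃ g g', Lens P k u v g g' := by
  obtain ⟨s, hs⟩ := h.exists_hull hfin hP huv
  have he : NonDel P u v := ⟨hu, hv, huv, fun r hr hur hvr =>
    h0 ⟨_, isOrderDT_isDel hfin hP hr.1 hr.2.1, r, hr, hur, hvr⟩⟩
  obtain ⟨a, ha, ha0⟩ := hs.exists_pos hP he
  obtain ⟨b, hb, hb0⟩ := hs.exists_neg hP he
  obtain ⟨g, hg⟩ := exists_cap hfin hP hu hv huv (hs.1.2.1 ha) ha0 h
  obtain ⟨g', hg'⟩ := exists_cap hfin hP hv hu huv.symm (hs.1.2.1 hb)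
    (by rw [hgt_swap]; linarith) h.symm
  exact ⟨g, g', he, hg, hg'⟩

lemma finite_usefulExactly (hfin : P.Finite) : (usefulExactly P k).Finite := by
  refine (finite_finsets hfin).subset ?_
  rintro e ⟨u, v, hu, hv, -, rfl, -⟩
  simp [insert_subset_iff, hu, hv]

lemma finite_isOrderDT (hfin : P.Finite) : {T | IsOrderDT P k T}.Finite :=
  (finite_finsets hfin).finite_subsets.subset fun _ hT t ht => (hT.1.2.1 t ht).2

lemma exists_disjoint_hulls (hfin : P.Finite) (hP : GenPos P) (hk : 0 < k) :
    ∃ (F : Finset (Finset Pt)) (x y : F → Pt), (usefulExactly P k).ncard ≤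
        F.card * ((4 * k + 2) * (2 * (k * (2 * k - 1)) + (2 * k - 1))) ∧
      (∀ e, ∃ g g', Lens P k (x e) (y e) g g') ∧
      (∀ e e' s, Hull P (x e) (y e) s → Hull P (x e') (y e') s → e = e') ∧
      ∀ e, UsefulEdge P k (x e) (y e) ∧ ∀ i < k, ¬ UsefulEdge P i (x e) (y e) := by
  classical
  have hE := finite_usefulExactly (k := k) hfin
  choose! x y hx hy hxy hxye hu hu' using fun (e : Finset Pt) (he : e ∈ usefulExactly P k) => he
  have hlens : ∀ e ∈ usefulExactly P k, ∃ g g', Lens P k (x e) (y e) g g' := fun e he =>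
    (hu e he).exists_lens hfin hP (hx e he) (hy e he) (hxy e he) (hu' e he 0 hk)
  obtain ⟨F, hFE, hF, hcard⟩ := hE.toFinset.exists_pairwiseDisjoint_card_le
    (fun e => (finite_hull (u := x e) (v := y e) hfin).toFinset) (m := 4 * k + 2)
    (d := 2 * (k * (2 * k - 1)) + (2 * k - 1))
    (fun e he => by
      rw [Finite.mem_toFinset] at he
      obtain ⟨s, hs⟩ := (hu e he).exists_hull hfin hP (hxy e he)
      exact ⟨s, (Finite.mem_toFinset _).2 hs⟩)
    (fun e he => by
      rw [Finite.mem_toFinset] at he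
      obtain ⟨g, g', h⟩ := hlens e he
      rw [← ncard_eq_toFinset_card _ (finite_hull hfin)]
      exact h.ncard_hull_le hfin hP)
    (fun s => by
      by_cases hs : IsDel P s
      · rw [← ncard_coe_finset]
        refine (ncard_le_ncard ?_ ?_).trans (ncard_lens_through_le hfin hP hs)
        · intro e he
          simp only [Finset.coe_filter, Finite.mem_toFinset, mem_ofPred_eq] at he
          exact ⟨x e, y e, hxye e he.1, hlens e he.1, he.2⟩
        · refine (finite_finsets hfin).subset ?_
          rintro e ⟨u, v, rfl, ⟨g, g', h⟩, -⟩
          simp [insert_subset_iff, h.nonDel.left, h.nonDel.right]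
      · rw [Finset.filter_false_of_mem fun e _ he => hs ((Finite.mem_toFinset _).1 he).1]
        simp)
  have hmem : ∀ e : F, (e : Finset Pt) ∈ usefulExactly P k := fun e =>
    (Finite.mem_toFinset _).1 (hFE e.2)
  refine ⟨F, fun e => x e, fun e => y e, ?_, fun e => hlens e (hmem e), ?_,
    fun e => ⟨hu e (hmem e), hu' e (hmem e)⟩⟩
  · rwa [ncard_eq_toFinset_card _ hE]
  · intro e e' s hs hs'
    by_contra hne
    exact Finset.disjoint_left.1 (hF e.2 e'.2 (Subtype.coe_injective.ne hne))
      ((Finite.mem_toFinset _).2 hs) ((Finite.mem_toFinset _).2 hs')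

lemma two_pow_card_le {ι : Type*} [Fintype ι] (hfin : P.Finite) (hP : GenPos P) {x y : ι → Pt}
    (hlens : ∀ i, ∃ g g', Lens P k (x i) (y i) g g')
    (hdisj : ∀ i j s, Hull P (x i) (y i) s → Hull P (x j) (y j) s → i = j)
    (hu : ∀ i, UsefulEdge P k (x i) (y i) ∧ ∀ j < k, ¬ UsefulEdge P j (x i) (y i)) :
    2 ^ Fintype.card ι ≤ {T | IsOrderDT P k T ∧ ∀ j < k, ¬ IsOrderDT P j T}.ncard + 1 := by
  classical
  have he : ∀ i, NonDel P (x i) (y i) := fun i => by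
    obtain ⟨g, g', h⟩ := hlens i
    exact h.nonDel
  have hcap : ∀ i, ∃ g, Cap P k (x i) (y i) g := fun i => by
    obtain ⟨g, g', h⟩ := hlens i
    exact ⟨g, h.cap⟩
  have hcap' : ∀ i, ∃ g, Cap P k (y i) (x i) g := fun i => by
    obtain ⟨g, g', h⟩ := hlens i
    exact ⟨g', h.cap'⟩
  have hmem := fun (S : Set ι) (i : ι) =>
    mem_iff_exists_mem_glue hfin hP he hcap hdisj (S := S) (i := i)
  have hcard : ((Finset.univ.erase (∅ : Set ι)) : Finset (Set ι)).card + 1 =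
      2 ^ Fintype.card ι := by
    rw [Finset.card_erase_add_one (Finset.mem_univ _), Finset.card_univ, Fintype.card_set]
  rw [← hcard, ← ncard_coe_finset]
  refine Nat.succ_le_succ (ncard_le_ncard_of_injOn (glue P x y) ?_ ?_
    ((finite_isOrderDT hfin).subset fun _ h => h.1))
  · intro S hS
    rw [Finset.mem_coe, Finset.mem_erase, ← Set.nonempty_iff_ne_empty] at hS
    obtain ⟨i, hi⟩ := hS.1
    obtain ⟨t, ht, hxt, hyt⟩ := (hmem S i).1 hi
    obtain ⟨h3, htP⟩ := glue_card_subset ht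
    exact ⟨⟨glue_isTriangulation hfin hP h3 htP he hdisj S, fun t ht =>
      glue_orderKTri hP he hcap hcap' ht⟩, fun j hj h => (hu i).2 j hj ⟨_, h, t, ht, hxt, hyt⟩⟩
  · intro S _ S' _ h
    ext i
    rw [hmem S i, hmem S' i, h]

end

/-- Lemma 2.13: if `P` has `e_k` useful order-`k` (and not useful order-`i` for `i < k`)
edges, `k > 1`, then `P` has at least `2 ^ (e_k / C_k) - 1` order-`k` (and not
order-`i` for any `i < k`) Delaunay triangulations, where `C_k = (4k+1)(2k+1)² + 1`. -/
theorem lower_bound_order_k_triangulations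
    (P : Set Pt) (hfin : P.Finite) (hgp : GenPos P) (k : ℕ) (hk : 1 < k) :
    (2 : ℝ) ^ (((usefulExactly P k).ncard : ℝ) /
        ((4 * (k : ℝ) + 1) * (2 * (k : ℝ) + 1) ^ 2 + 1)) - 1 ≤
      ({T : Set (Finset Pt) | IsOrderDT P k T ∧ ∀ i < k, ¬ IsOrderDT P i T}.ncard : ℝ) := by
  obtain ⟨F, x, y, hcard, hlens, hdisj, hu⟩ :=
    exists_disjoint_hulls (k := k) hfin hgp (Nat.zero_lt_of_lt hk)
  have h := two_pow_card_le hfin hgp hlens hdisj hu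
  rw [Fintype.card_coe] at h
  have h2 : (usefulExactly P k).ncard ≤ F.card * ((4 * k + 1) * (2 * k + 1) ^ 2 + 1) := by
    refine hcard.trans (Nat.mul_le_mul_left _ ?_)
    obtain ⟨j, rfl⟩ := Nat.exists_eq_add_of_lt hk
    have : 2 * (1 + j + 1) - 1 = 2 * j + 3 := by omega
    rw [this]
    ring_nf
    gcongr <;> norm_num
  have h3 : ((usefulExactly P k).ncard : ℝ) / ((4 * (k : ℝ) + 1) * (2 * (k : ℝ) + 1) ^ 2 + 1) ≤
      F.card := by
    rw [div_le_iff₀ (by positivity)]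
    exact_mod_cast h2
  have h4 := Real.rpow_le_rpow_of_exponent_le (x := 2) one_le_two h3
  rw [Real.rpow_natCast] at h4
  have h5 : (2 : ℝ) ^ F.card ≤
      ({T : Set (Finset Pt) | IsOrderDT P k T ∧ ∀ i < k, ¬ IsOrderDT P i T}.ncard : ℝ) + 1 := by
    exact_mod_cast h
  linarith

end
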